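/- Let Ω ⊂ ℝ² be a bounded open set, θ ∈ (0, 1/4), φ : ℝ² → ℝ a C^∞ function with |Dφ| ≤ 1 − 4θ on the closure of Ω, and Λ ≥ 0. Let Ω′ ⊆ Ω be open, ε > 0 and I₁, I₂ ≥ 0. Then there exists a constant C, depending only on Ω, φ, θ, Λ, Ω′, ε, I₁ and I₂, such that every admissible solution u with source ρ satisfying ∫_Ω |ρ| dx ≤ I₁ and (∫_{Ω′} ρ² dx)^{1/2} ≤ I₂ obeys the higher integrability estimate ∫_{Ω′_ε} w_u ln(1 + w_u) dx ≤ C. -/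

import Mathlib

open MeasureTheory Metric Set
open scoped ENNReal NNReal Topology

noncomputable section

/-- The tilt function `w_u = (1 - |Du|²)^{-1/2}`. -/
noncomputable def tilt {m : ℕ} (u : EuclideanSpace ℝ (Fin m) → ℝ)
    (x : EuclideanSpace ℝ (Fin m)) : ℝ :=
  (Real.sqrt (1 - ‖gradient u x‖ ^ 2))⁻¹

/-- `div(w_u Du)(x) = Σ_i ∂_i (w_u ∂_i u)(x)`, the Lorentzian mean curvature of the
graph of `u` in Minkowski space. -/
noncomputable def lorentzMeanCurv {m : ℕ} (u : EuclideanSpace ℝ (Fin m) → ℝ)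
    (x : EuclideanSpace ℝ (Fin m)) : ℝ :=
  ∑ i, gradient (fun y => tilt u y * (gradient u y) i) x i

/-- Admissible solution with source `ρ` for the data `(Ω, φ, Λ)`. -/
def IsAdmissible {m : ℕ} (Ω : Set (EuclideanSpace ℝ (Fin m)))
    (φ : EuclideanSpace ℝ (Fin m) → ℝ) (Λ : ℝ)
    (u ρ : EuclideanSpace ℝ (Fin m) → ℝ) : Prop :=
  (∃ V : Set (EuclideanSpace ℝ (Fin m)), IsOpen V ∧ closure Ω ⊆ V ∧ ContDiffOn ℝ (⊤ : ℕ∞) u V) ∧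
  (∀ x ∈ closure Ω, ‖gradient u x‖ < 1) ∧
  (∀ x ∈ frontier Ω, u x = φ x) ∧
  ContinuousOn ρ Ω ∧
  (∀ x ∈ Ω, |lorentzMeanCurv u x - ρ x| ≤ Λ * tilt u x)

/-- The `i`-th partial derivative of a function on the Euclidean plane. -/
def pderiv (i : Fin 2) (F : EuclideanSpace ℝ (Fin 2) → ℝ) (x : EuclideanSpace ℝ (Fin 2)) : ℝ :=
  fderiv ℝ F x (EuclideanSpace.single i 1)

section Product

lemma HasCompactSupport.slice_left {f : ℝ × ℝ → ℝ} (hf : HasCompactSupport f) (s : ℝ) :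
    HasCompactSupport fun t => f (s, t) :=
  hf.comp_isClosedEmbedding (Function.LeftInverse.isClosedEmbedding (f := Prod.snd) (fun _ => rfl)
    (by fun_prop) (by fun_prop))

lemma HasCompactSupport.slice_right {f : ℝ × ℝ → ℝ} (hf : HasCompactSupport f) (t : ℝ) :
    HasCompactSupport fun s => f (s, t) :=
  hf.comp_isClosedEmbedding (Function.LeftInverse.isClosedEmbedding (f := Prod.fst) (fun _ => rfl)
    (by fun_prop) (by fun_prop))

lemma deriv_slice_left {f : ℝ × ℝ → ℝ} (hf : ContDiff ℝ 1 f) (s t : ℝ) :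
    deriv (fun t => f (s, t)) t = fderiv ℝ f (s, t) (0, 1) :=
  ((hf.differentiable one_ne_zero (s, t)).hasFDerivAt.comp_hasDerivAt t
    ((hasDerivAt_const t s).prodMk (hasDerivAt_id t))).deriv

lemma deriv_slice_right {f : ℝ × ℝ → ℝ} (hf : ContDiff ℝ 1 f) (s t : ℝ) :
    deriv (fun s => f (s, t)) s = fderiv ℝ f (s, t) (1, 0) :=
  ((hf.differentiable one_ne_zero (s, t)).hasFDerivAt.comp_hasDerivAt s
    ((hasDerivAt_id s).prodMk (hasDerivAt_const s t))).deriv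

lemma continuous_fderiv_apply_const {E : Type*} [NormedAddCommGroup E] [NormedSpace ℝ E]
    {f : E → ℝ} (hf : ContDiff ℝ 1 f) (v : E) : Continuous fun x => fderiv ℝ f x v :=
  (hf.continuous_fderiv one_ne_zero).clm_apply continuous_const

lemma integrable_fderiv_apply_const {f : ℝ × ℝ → ℝ} (hf : ContDiff ℝ 1 f)
    (hc : HasCompactSupport f) (v : ℝ × ℝ) : Integrable fun x => fderiv ℝ f x v :=
  (continuous_fderiv_apply_const hf v).integrable_of_hasCompactSupport
    (hc.fderiv_apply (𝕜 := ℝ) v)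

/-- A function vanishing at infinity is bounded by the integral of its derivative on lines. -/
lemma le_integral_abs_fderiv_slice {f : ℝ × ℝ → ℝ} (hf : ContDiff ℝ 1 f)
    (hc : HasCompactSupport f) (s t : ℝ) : f (s, t) ≤ ∫ r, |fderiv ℝ f (s, r) (0, 1)| := by
  have hs : ContDiff ℝ 1 fun t => f (s, t) := hf.comp (by fun_prop)
  have h := (hc.slice_left s).integral_Iic_deriv_eq hs t
  have hi : Integrable fun r => |fderiv ℝ f (s, r) (0, 1)| := by
    have := (hs.continuous_deriv le_rfl).integrable_of_hasCompactSupport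
      (hc.slice_left s).deriv (μ := volume)
    rw [funext (deriv_slice_left hf s)] at this
    exact this.abs
  simp only [deriv_slice_left hf] at h
  rw [← h]
  calc ∫ r in Iic t, fderiv ℝ f (s, r) (0, 1) ≤ ∫ r in Iic t, |fderiv ℝ f (s, r) (0, 1)| :=
        (le_abs_self _).trans abs_integral_le_integral_abs
    _ ≤ _ := setIntegral_le_integral hi (.of_forall fun _ => abs_nonneg _)

lemma integral_fderiv_slice_eq_zero {f : ℝ × ℝ → ℝ} (hf : ContDiff ℝ 1 f)
    (hc : HasCompactSupport f) (s : ℝ) : ∫ t, fderiv ℝ f (s, t) (0, 1) = 0 := by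
  have hs : ContDiff ℝ 1 fun t => f (s, t) := hf.comp (by fun_prop)
  have := integral_eq_zero_of_hasDerivAt_of_integrable
    (fun t => (hs.differentiable one_ne_zero t).hasDerivAt)
    ((hs.continuous_deriv le_rfl).integrable_of_hasCompactSupport (hc.slice_left s).deriv)
    (hs.continuous.integrable_of_hasCompactSupport (hc.slice_left s))
  simpa only [deriv_slice_left hf] using this

/-- The flux of a compactly supported field through a line is bounded by the total divergence. -/
lemma integral_slice_le_integral_abs_div {Y Z : ℝ × ℝ → ℝ} (hY : ContDiff ℝ 1 Y)
    (hYc : HasCompactSupport Y) (hZ : ContDiff ℝ 1 Z) (hZc : HasCompactSupport Z) (s : ℝ) :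
    ∫ t, Y (s, t) ≤ ∫ x : ℝ × ℝ, |fderiv ℝ Y x (1, 0) + fderiv ℝ Z x (0, 1)| := by
  have hYi := integrable_fderiv_apply_const hY hYc (1, 0)
  have hZi := integrable_fderiv_apply_const hZ hZc (0, 1)
  have hD := (hYi.add hZi).abs
  have h1 : ∀ t, Y (s, t) = ∫ r in Iic s, fderiv ℝ Y (r, t) (1, 0) := fun t => by
    have hs : ContDiff ℝ 1 fun s => Y (s, t) := hY.comp (by fun_prop)
    have := (hYc.slice_right t).integral_Iic_deriv_eq hs s
    simpa only [deriv_slice_right hY] using this.symm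
  have hres : Integrable (fun z : ℝ × ℝ => fderiv ℝ Y z (1, 0))
      ((volume.restrict (Iic s)).prod volume) := by
    refine hYi.mono_measure ?_
    exact Measure.prod_mono Measure.restrict_le_self le_rfl
  calc ∫ t, Y (s, t) = ∫ t, ∫ r in Iic s, fderiv ℝ Y (r, t) (1, 0) := by simp_rw [h1]
    _ = ∫ r in Iic s, ∫ t, fderiv ℝ Y (r, t) (1, 0) := (integral_integral_swap hres).symm
    _ ≤ ∫ r in Iic s, ∫ t, |fderiv ℝ Y (r, t) (1, 0) + fderiv ℝ Z (r, t) (0, 1)| := by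
      refine integral_mono_ae hres.integral_prod_left hD.integral_prod_left.integrableOn ?_
      filter_upwards [ae_restrict_of_ae hYi.prod_right_ae, ae_restrict_of_ae hZi.prod_right_ae]
        with r hr hr'
      calc ∫ t, fderiv ℝ Y (r, t) (1, 0)
          = ∫ t, (fderiv ℝ Y (r, t) (1, 0) + fderiv ℝ Z (r, t) (0, 1)) := by
            rw [integral_add hr hr', integral_fderiv_slice_eq_zero hZ hZc, add_zero]
        _ ≤ _ := (le_abs_self _).trans abs_integral_le_integral_abs
    _ ≤ ∫ r, ∫ t, |fderiv ℝ Y (r, t) (1, 0) + fderiv ℝ Z (r, t) (0, 1)| :=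
      setIntegral_le_integral hD.integral_prod_left
        (.of_forall fun _ => integral_nonneg fun _ => abs_nonneg _)
    _ = _ := (integral_prod _ hD).symm

/-- Anisotropic product estimate on `ℝ × ℝ`. -/
lemma integral_mul_le_integral_abs_mul_integral_abs_div {f Y Z : ℝ × ℝ → ℝ} (hf : ContDiff ℝ 1 f)
    (hfc : HasCompactSupport f) (hY : ContDiff ℝ 1 Y) (hYc : HasCompactSupport Y)
    (hZ : ContDiff ℝ 1 Z) (hZc : HasCompactSupport Z) (hY0 : ∀ x, 0 ≤ Y x) :
    ∫ x, f x * Y x ≤ (∫ x, |fderiv ℝ f x (0, 1)|) *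
      ∫ x, |fderiv ℝ Y x (1, 0) + fderiv ℝ Z x (0, 1)| := by
  have hfi := (integrable_fderiv_apply_const hf hfc (0, 1)).abs
  have hfY : Integrable fun x => f x * Y x :=
    (hf.continuous.mul hY.continuous).integrable_of_hasCompactSupport hYc.mul_left
  set D := ∫ x, |fderiv ℝ Y x (1, 0) + fderiv ℝ Z x (0, 1)| with hD
  calc ∫ x, f x * Y x = ∫ s, ∫ t, f (s, t) * Y (s, t) := integral_prod _ hfY
    _ ≤ ∫ s, (∫ t, |fderiv ℝ f (s, t) (0, 1)|) * D := by
      refine integral_mono_ae hfY.integral_prod_left (hfi.integral_prod_left.mul_const D) ?_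
      filter_upwards [hfY.prod_right_ae] with s hs
      have hYs : Integrable fun t => Y (s, t) :=
        (hY.continuous.comp (by fun_prop)).integrable_of_hasCompactSupport (hYc.slice_left s)
      calc ∫ t, f (s, t) * Y (s, t)
          ≤ ∫ t, (∫ r, |fderiv ℝ f (s, r) (0, 1)|) * Y (s, t) :=
            integral_mono hs (hYs.const_mul _) fun t =>
              mul_le_mul_of_nonneg_right (le_integral_abs_fderiv_slice hf hfc s t) (hY0 _)
        _ = (∫ r, |fderiv ℝ f (s, r) (0, 1)|) * ∫ t, Y (s, t) := integral_const_mul _ _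
        _ ≤ _ := mul_le_mul_of_nonneg_left
            (integral_slice_le_integral_abs_div hY hYc hZ hZc s)
            (integral_nonneg fun _ => abs_nonneg _)
    _ = (∫ s, ∫ t, |fderiv ℝ f (s, t) (0, 1)|) * D := integral_mul_const _ _
    _ = _ := by rw [← integral_prod _ hfi, Measure.volume_eq_prod]

end Product

section CompactlySupported

variable {U K : Set (EuclideanSpace ℝ (Fin 2))} {F : EuclideanSpace ℝ (Fin 2) → ℝ}

lemma contDiff_indicator_of_eq_zero_off_compact (hU : IsOpen U) (hK : IsCompact K) (hKU : K ⊆ U)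
    {n : WithTop ℕ∞} (hF : ContDiffOn ℝ n F U) (h0 : ∀ x ∈ U, x ∉ K → F x = 0) :
    ContDiff ℝ n (U.indicator F) := by
  refine contDiff_iff_contDiffAt.2 fun x => ?_
  by_cases hx : x ∈ U
  · refine (hF.contDiffAt (hU.mem_nhds hx)).congr_of_eventuallyEq ?_
    filter_upwards [hU.mem_nhds hx] with y hy using indicator_of_mem hy F
  · refine (contDiffAt_const (c := (0 : ℝ))).congr_of_eventuallyEq ?_
    filter_upwards [hK.isClosed.isOpen_compl.mem_nhds fun h => hx (hKU h)] with y hy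
    by_cases hyU : y ∈ U
    · rw [indicator_of_mem hyU, h0 y hyU hy]
    · exact indicator_of_notMem hyU F

lemma hasCompactSupport_indicator_of_eq_zero_off_compact (hK : IsCompact K)
    (h0 : ∀ x ∈ U, x ∉ K → F x = 0) : HasCompactSupport (U.indicator F) := by
  refine HasCompactSupport.intro hK fun x hx => ?_
  by_cases hxU : x ∈ U
  · rw [indicator_of_mem hxU, h0 x hxU hx]
  · exact indicator_of_notMem hxU F

lemma pderiv_indicator (hU : IsOpen U) (hK : IsCompact K) (hKU : K ⊆ U)
    (h0 : ∀ x ∈ U, x ∉ K → F x = 0) (i : Fin 2) :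
    pderiv i (U.indicator F) = U.indicator (pderiv i F) := by
  ext x
  by_cases hx : x ∈ U
  · have : U.indicator F =ᶠ[𝓝 x] F := by
      filter_upwards [hU.mem_nhds hx] with y hy using indicator_of_mem hy F
    rw [indicator_of_mem hx, pderiv, this.fderiv_eq, pderiv]
  · have : U.indicator F =ᶠ[𝓝 x] fun _ => 0 := by
      filter_upwards [hK.isClosed.isOpen_compl.mem_nhds fun h => hx (hKU h)] with y hy
      by_cases hyU : y ∈ U
      · rw [indicator_of_mem hyU, h0 y hyU hy]
      · exact indicator_of_notMem hyU F
    rw [indicator_of_notMem hx, pderiv, this.fderiv_eq]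
    simp

lemma continuous_pderiv {i : Fin 2} (hF : ContDiff ℝ 1 F) : Continuous (pderiv i F) :=
  continuous_fderiv_apply_const hF _

lemma HasCompactSupport.pderiv {i : Fin 2} (hF : HasCompactSupport F) :
    HasCompactSupport (pderiv i F) :=
  hF.fderiv_apply (𝕜 := ℝ) _

lemma integral_pderiv_eq_zero (hF : ContDiff ℝ 1 F) (hc : HasCompactSupport F) (i : Fin 2) :
    ∫ x, pderiv i F x = 0 := by
  have h := integral_mul_fderiv_eq_neg_fderiv_mul_of_integrable (μ := volume) (f := F)
    (g := fun _ => (1 : ℝ)) (v := EuclideanSpace.single i 1)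
    (by simpa only [mul_one] using!
      (continuous_pderiv hF).integrable_of_hasCompactSupport hc.pderiv)
    (by simp) (by simpa using hF.continuous.integrable_of_hasCompactSupport hc)
    (fun x _ => hF.differentiable one_ne_zero x) (by simp)
  simpa [_root_.pderiv] using h.symm

/-- Divergence theorem for functions vanishing off a compact subset of an open set. -/
lemma setIntegral_pderiv_eq_zero (hU : IsOpen U) (hK : IsCompact K) (hKU : K ⊆ U)
    (hF : ContDiffOn ℝ 1 F U) (h0 : ∀ x ∈ U, x ∉ K → F x = 0) (i : Fin 2) :
    ∫ x in U, pderiv i F x = 0 := by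
  rw [← integral_indicator hU.measurableSet, ← pderiv_indicator hU hK hKU h0]
  exact integral_pderiv_eq_zero (contDiff_indicator_of_eq_zero_off_compact hU hK hKU hF h0)
    (hasCompactSupport_indicator_of_eq_zero_off_compact hK h0) i

/-- The linear isometric chart of the plane whose first coordinate is the `k`-th one. -/
def planeChart (k : Fin 2) : ℝ × ℝ →L[ℝ] EuclideanSpace ℝ (Fin 2) :=
  (ContinuousLinearMap.fst ℝ ℝ ℝ).smulRight (EuclideanSpace.single k 1) +
    (ContinuousLinearMap.snd ℝ ℝ ℝ).smulRight (EuclideanSpace.single (1 - k) 1)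

lemma exists_measurableEquiv_planeChart (k : Fin 2) :
    ∃ e : ℝ × ℝ ≃ᵐ EuclideanSpace ℝ (Fin 2), MeasurePreserving e ∧ ⇑e = planeChart k := by
  have h0 : MeasurePreserving (MeasurableEquiv.finTwoArrow.symm.trans
      (MeasurableEquiv.toLp 2 (Fin 2 → ℝ))) (volume : Measure (ℝ × ℝ)) volume :=
    (volume_preserving_finTwoArrow ℝ).symm.trans
      (EuclideanSpace.volume_preserving_symm_measurableEquiv_toLp (Fin 2)).symm
  have h1 : MeasurePreserving (MeasurableEquiv.prodComm : ℝ × ℝ ≃ᵐ ℝ × ℝ) volume volume :=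
    Measure.measurePreserving_swap
  fin_cases k
  · refine ⟨_, h0, ?_⟩
    ext x i
    fin_cases i <;> simp [planeChart, MeasurableEquiv.finTwoArrow, MeasurableEquiv.piFinTwo]
  · refine ⟨_, h1.trans h0, ?_⟩
    ext x i
    fin_cases i <;>
      simp [planeChart, MeasurableEquiv.finTwoArrow, MeasurableEquiv.piFinTwo,
        MeasurableEquiv.prodComm]

lemma integral_comp_planeChart (k : Fin 2) (g : EuclideanSpace ℝ (Fin 2) → ℝ) :
    ∫ z, g (planeChart k z) = ∫ x, g x := by
  obtain ⟨e, he, hek⟩ := exists_measurableEquiv_planeChart k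
  rw [← hek]
  exact he.integral_comp' g

lemma hasCompactSupport_comp_planeChart (k : Fin 2) (hF : HasCompactSupport F) :
    HasCompactSupport fun z => F (planeChart k z) := by
  refine hF.comp_isClosedEmbedding (Function.LeftInverse.isClosedEmbedding
    (f := fun x : EuclideanSpace ℝ (Fin 2) => (x k, x (1 - k))) (fun z => ?_)
    (by fun_prop) (by fun_prop))
  fin_cases k <;> simp [planeChart]

lemma fderiv_comp_planeChart (k : Fin 2) (hF : ContDiff ℝ 1 F) (z : ℝ × ℝ) :
    fderiv ℝ (fun z => F (planeChart k z)) z (1, 0) = pderiv k F (planeChart k z) ∧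
    fderiv ℝ (fun z => F (planeChart k z)) z (0, 1) = pderiv (1 - k) F (planeChart k z) := by
  have := ((hF.differentiable one_ne_zero (planeChart k z)).hasFDerivAt.comp z
    (planeChart k).hasFDerivAt).fderiv
  simp only [Function.comp_def] at this
  rw [this]
  simp [planeChart, pderiv]

/-- Anisotropic product estimate: a compactly supported function `f` tested against the `k`-th
component of a field with integrable divergence, when that component is nonnegative. -/
lemma setIntegral_mul_le_of_div (hU : IsOpen U) (hK : IsCompact K) (hKU : K ⊆ U) (k : Fin 2)
    {f : EuclideanSpace ℝ (Fin 2) → ℝ} {Y : Fin 2 → EuclideanSpace ℝ (Fin 2) → ℝ}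
    (hf : ContDiffOn ℝ 1 f U) (hf0 : ∀ x ∈ U, x ∉ K → f x = 0)
    (hY : ∀ i, ContDiffOn ℝ 1 (Y i) U) (hY0 : ∀ i, ∀ x ∈ U, x ∉ K → Y i x = 0)
    (hpos : ∀ x ∈ U, 0 ≤ Y k x) :
    ∫ x in U, f x * Y k x ≤ (∫ x in U, |pderiv (1 - k) f x|) *
      ∫ x in U, |∑ i, pderiv i (Y i) x| := by
  have hfs := contDiff_indicator_of_eq_zero_off_compact hU hK hKU hf hf0
  have hfc := hasCompactSupport_indicator_of_eq_zero_off_compact hK hf0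
  have hYs := fun i => contDiff_indicator_of_eq_zero_off_compact hU hK hKU (hY i) (hY0 i)
  have hYc := fun i => hasCompactSupport_indicator_of_eq_zero_off_compact hK (hY0 i)
  have hL : ContDiff ℝ 1 (planeChart k) := (planeChart k).contDiff
  have key := integral_mul_le_integral_abs_mul_integral_abs_div
    (hfs.comp hL) (hasCompactSupport_comp_planeChart k hfc)
    ((hYs k).comp hL) (hasCompactSupport_comp_planeChart k (hYc k))
    ((hYs (1 - k)).comp hL) (hasCompactSupport_comp_planeChart k (hYc (1 - k)))
    (fun z => indicator_nonneg hpos _)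
  simp only [Function.comp_def, fderiv_comp_planeChart k hfs, fderiv_comp_planeChart k (hYs _)]
    at key
  rw [integral_comp_planeChart k fun x => U.indicator f x * U.indicator (Y k) x,
    integral_comp_planeChart k fun x => |pderiv (1 - k) (U.indicator f) x|,
    integral_comp_planeChart k fun x => |pderiv k (U.indicator (Y k)) x +
      pderiv (1 - k) (U.indicator (Y (1 - k))) x|] at key
  simp only [pderiv_indicator hU hK hKU hf0, pderiv_indicator hU hK hKU (hY0 _)] at key
  have e1 : (U.indicator fun x => f x * Y k x) =
      fun x => U.indicator f x * U.indicator (Y k) x := by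
    ext x; by_cases hx : x ∈ U <;> simp [hx]
  have e2 : (U.indicator fun x => |pderiv (1 - k) f x|) =
      fun x => |U.indicator (pderiv (1 - k) f) x| := by
    ext x; by_cases hx : x ∈ U <;> simp [hx]
  have e3 : (U.indicator fun x => |∑ i, pderiv i (Y i) x|) =
      fun x => |U.indicator (pderiv k (Y k)) x +
        U.indicator (pderiv (1 - k) (Y (1 - k))) x| := by
    ext x
    by_cases hx : x ∈ U
    · fin_cases k <;> simp [hx, Fin.sum_univ_two, add_comm]
    · simp [hx]
  rw [← integral_indicator hU.measurableSet, ← integral_indicator hU.measurableSet,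
    ← integral_indicator hU.measurableSet, e1, e2, e3]
  exact key

lemma pderiv_eq_zero_off_compact (hU : IsOpen U) (hK : IsCompact K)
    (h0 : ∀ x ∈ U, x ∉ K → F x = 0) (i : Fin 2) : ∀ x ∈ U, x ∉ K → pderiv i F x = 0 := by
  intro x hx hxK
  have : F =ᶠ[𝓝 x] fun _ => 0 := by
    filter_upwards [hU.mem_nhds hx, hK.isClosed.isOpen_compl.mem_nhds hxK] with y hy hyK
      using h0 y hy hyK
  rw [pderiv, this.fderiv_eq]
  simp

lemma setIntegral_eq_of_eq_zero_off_compact (hU : IsOpen U) (hKU : K ⊆ U)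
    (h0 : ∀ x ∈ U, x ∉ K → F x = 0) : ∫ x in U, F x = ∫ x in K, F x :=
  setIntegral_eq_of_subset_of_forall_sdiff_eq_zero hU.measurableSet hKU fun x hx => h0 x hx.1 hx.2

/-- Divergence theorem for functions vanishing off a compact set. -/
lemma setIntegral_compact_pderiv_eq_zero (hU : IsOpen U) (hK : IsCompact K) (hKU : K ⊆ U)
    (hF : ContDiffOn ℝ 1 F U) (h0 : ∀ x ∈ U, x ∉ K → F x = 0) (i : Fin 2) :
    ∫ x in K, pderiv i F x = 0 := by
  rw [← setIntegral_eq_of_eq_zero_off_compact hU hKU (pderiv_eq_zero_off_compact hU hK h0 i)]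
  exact setIntegral_pderiv_eq_zero hU hK hKU hF h0 i

lemma setIntegral_compact_mul_le_of_div (hU : IsOpen U) (hK : IsCompact K) (hKU : K ⊆ U)
    (k : Fin 2) {f : EuclideanSpace ℝ (Fin 2) → ℝ} {Y : Fin 2 → EuclideanSpace ℝ (Fin 2) → ℝ}
    (hf : ContDiffOn ℝ 1 f U) (hf0 : ∀ x ∈ U, x ∉ K → f x = 0)
    (hY : ∀ i, ContDiffOn ℝ 1 (Y i) U) (hY0 : ∀ i, ∀ x ∈ U, x ∉ K → Y i x = 0)
    (hpos : ∀ x ∈ U, 0 ≤ Y k x) :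
    ∫ x in K, f x * Y k x ≤ (∫ x in K, |pderiv (1 - k) f x|) *
      ∫ x in K, |∑ i, pderiv i (Y i) x| := by
  have h := setIntegral_mul_le_of_div hU hK hKU k hf hf0 hY hY0 hpos
  rwa [setIntegral_eq_of_eq_zero_off_compact hU hKU fun x hx hxK => by rw [hf0 x hx hxK, zero_mul],
    setIntegral_eq_of_eq_zero_off_compact hU hKU fun x hx hxK => by
      rw [pderiv_eq_zero_off_compact hU hK hf0 _ x hx hxK, abs_zero],
    setIntegral_eq_of_eq_zero_off_compact hU hKU fun x hx hxK => by
      simp [pderiv_eq_zero_off_compact hU hK (hY0 _) _ x hx hxK]] at h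

end CompactlySupported

section Calculus

variable {U : Set (EuclideanSpace ℝ (Fin 2))} {F G u : EuclideanSpace ℝ (Fin 2) → ℝ}
  {x : EuclideanSpace ℝ (Fin 2)} {i : Fin 2}

lemma pderiv_add (hF : DifferentiableAt ℝ F x) (hG : DifferentiableAt ℝ G x) :
    pderiv i (fun y => F y + G y) x = pderiv i F x + pderiv i G x := by
  simp only [pderiv, fderiv_fun_add hF hG]; rfl

lemma pderiv_sub (hF : DifferentiableAt ℝ F x) (hG : DifferentiableAt ℝ G x) :
    pderiv i (fun y => F y - G y) x = pderiv i F x - pderiv i G x := by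
  simp only [pderiv, fderiv_fun_sub hF hG]; rfl

lemma pderiv_mul (hF : DifferentiableAt ℝ F x) (hG : DifferentiableAt ℝ G x) :
    pderiv i (fun y => F y * G y) x = pderiv i F x * G x + F x * pderiv i G x := by
  simp only [pderiv, fderiv_fun_mul hF hG]
  simp; ring

lemma pderiv_neg : pderiv i (fun y => -F y) x = -pderiv i F x := by
  simp [pderiv]

lemma pderiv_comp {f : ℝ → ℝ} {f' : ℝ} (hf : HasDerivAt f f' (F x)) (hF : DifferentiableAt ℝ F x) :
    pderiv i (fun y => f (F y)) x = f' * pderiv i F x := by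
  have := (hf.comp_hasFDerivAt x hF.hasFDerivAt).fderiv
  simp only [Function.comp_def] at this
  simp [pderiv, this]

lemma gradient_apply_eq_pderiv : gradient F x i = pderiv i F x := by
  have h : inner ℝ (gradient F x) (EuclideanSpace.single i 1) = pderiv i F x := inner_gradient_left
  rw [EuclideanSpace.inner_single_right] at h
  simpa using h

lemma norm_gradient_sq : ‖gradient u x‖ ^ 2 = pderiv 0 u x ^ 2 + pderiv 1 u x ^ 2 := by
  rw [EuclideanSpace.norm_sq_eq]
  simp [Fin.sum_univ_two, gradient_apply_eq_pderiv]

lemma norm_gradient_eq_norm_fderiv : ‖gradient u x‖ = ‖fderiv ℝ u x‖ := by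
  rw [gradient, LinearIsometryEquiv.norm_map]

lemma tilt_eq : tilt u x = (Real.sqrt (1 - (pderiv 0 u x ^ 2 + pderiv 1 u x ^ 2)))⁻¹ := by
  rw [tilt, norm_gradient_sq]

lemma sq_add_sq_lt_one (h : ‖gradient u x‖ < 1) : pderiv 0 u x ^ 2 + pderiv 1 u x ^ 2 < 1 := by
  rw [← norm_gradient_sq]
  nlinarith [norm_nonneg (gradient u x)]

lemma tilt_nonneg : 0 ≤ tilt u x := inv_nonneg.2 (Real.sqrt_nonneg _)

lemma tilt_pos (h : ‖gradient u x‖ < 1) : 0 < tilt u x := by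
  rw [tilt_eq]
  have := sq_add_sq_lt_one h
  exact inv_pos.2 (Real.sqrt_pos.2 (by linarith))

lemma tilt_sq_mul (h : ‖gradient u x‖ < 1) :
    tilt u x ^ 2 * (1 - (pderiv 0 u x ^ 2 + pderiv 1 u x ^ 2)) = 1 := by
  have h1 := sq_add_sq_lt_one h
  rw [tilt_eq, inv_pow, Real.sq_sqrt (by linarith)]
  exact inv_mul_cancel₀ (by linarith)

lemma one_le_tilt (h : ‖gradient u x‖ < 1) : 1 ≤ tilt u x := by
  have h1 := tilt_sq_mul h
  have h2 := tilt_pos h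
  nlinarith [sq_nonneg (pderiv 0 u x), sq_nonneg (pderiv 1 u x), sq_nonneg (tilt u x),
    mul_nonneg (sq_nonneg (tilt u x)) (add_nonneg (sq_nonneg (pderiv 0 u x))
      (sq_nonneg (pderiv 1 u x)))]

lemma contDiffOn_pderiv (hU : IsOpen U) {m n : WithTop ℕ∞} (hF : ContDiffOn ℝ n F U)
    (hmn : m + 1 ≤ n) : ContDiffOn ℝ m (pderiv i F) U :=
  (hF.fderiv_of_isOpen hU hmn).clm_apply contDiffOn_const

lemma contDiffOn_tilt (hU : IsOpen U) {m n : WithTop ℕ∞} (hu : ContDiffOn ℝ n u U)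
    (hmn : m + 1 ≤ n) (hg : ∀ x ∈ U, ‖gradient u x‖ < 1) : ContDiffOn ℝ m (tilt u) U := by
  have h : ∀ i, ContDiffOn ℝ m (pderiv i u) U := fun i => contDiffOn_pderiv hU hu hmn
  have e : tilt u = fun x => (Real.sqrt (1 - (pderiv 0 u x ^ 2 + pderiv 1 u x ^ 2)))⁻¹ :=
    funext fun x => tilt_eq
  rw [e]
  have hp : ∀ x ∈ U, 0 < 1 - (pderiv 0 u x ^ 2 + pderiv 1 u x ^ 2) := fun x hx => by
    linarith [sq_add_sq_lt_one (hg x hx)]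
  refine ContDiffOn.inv (ContDiffOn.sqrt ?_ fun x hx => (hp x hx).ne') fun x hx =>
    (Real.sqrt_pos.2 (hp x hx)).ne'
  exact contDiffOn_const.sub (((h 0).pow 2).add ((h 1).pow 2))

lemma ContDiffOn.differentiableAt_of_isOpen (hU : IsOpen U) (hF : ContDiffOn ℝ 1 F U)
    (hx : x ∈ U) : DifferentiableAt ℝ F x :=
  (hF.contDiffAt (hU.mem_nhds hx)).differentiableAt one_ne_zero

lemma pderiv_comm (hU : IsOpen U) (hF : ContDiffOn ℝ 2 F U) (hx : x ∈ U) (i j : Fin 2) :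
    pderiv i (pderiv j F) x = pderiv j (pderiv i F) x := by
  have hd : DifferentiableAt ℝ (fderiv ℝ F) x :=
    ((hF.fderiv_of_isOpen hU (m := 1) (by norm_num)).contDiffAt
      (hU.mem_nhds hx)).differentiableAt one_ne_zero
  have e : ∀ i j, pderiv i (pderiv j F) x =
      fderiv ℝ (fderiv ℝ F) x (EuclideanSpace.single i 1) (EuclideanSpace.single j 1) := by
    intro i j
    have := (hd.hasFDerivAt.clm_apply
      (hasFDerivAt_const (EuclideanSpace.single j (1 : ℝ)) x)).fderiv
    unfold pderiv
    rw [this]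
    simp
  rw [e, e]
  exact ((hF.contDiffAt (hU.mem_nhds hx)).isSymmSndFDerivAt (by simp)).eq _ _

lemma pderiv_tilt (hU : IsOpen U) (hu : ContDiffOn ℝ 2 u U)
    (hg : ∀ x ∈ U, ‖gradient u x‖ < 1) (hx : x ∈ U) :
    pderiv i (tilt u) x = tilt u x ^ 3 * (pderiv 0 u x * pderiv i (pderiv 0 u) x +
      pderiv 1 u x * pderiv i (pderiv 1 u) x) := by
  have hw : DifferentiableAt ℝ (tilt u) x :=
    (contDiffOn_tilt hU hu (m := 1) (by norm_num) hg).differentiableAt_of_isOpen hU hx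
  have hd : ∀ j, DifferentiableAt ℝ (pderiv j u) x := fun j =>
    (contDiffOn_pderiv hU hu (m := 1) (by norm_num)).differentiableAt_of_isOpen hU hx
  have hc : (fun y => (tilt u y * tilt u y) *
      (1 - (pderiv 0 u y * pderiv 0 u y + pderiv 1 u y * pderiv 1 u y))) =ᶠ[𝓝 x] fun _ => 1 := by
    filter_upwards [hU.mem_nhds hx] with y hy
    linarith [tilt_sq_mul (hg y hy)]
  have h1 : pderiv i (fun y => (tilt u y * tilt u y) *
      (1 - (pderiv 0 u y * pderiv 0 u y + pderiv 1 u y * pderiv 1 u y))) x = 0 := by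
    rw [pderiv, hc.fderiv_eq]; simp
  have hpq := ((hd 0).fun_mul (hd 0)).fun_add ((hd 1).fun_mul (hd 1))
  rw [pderiv_mul (hw.fun_mul hw) ((differentiableAt_const _).fun_sub hpq), pderiv_mul hw hw,
    pderiv_sub (differentiableAt_const _) hpq, pderiv_add ((hd 0).fun_mul (hd 0)) ((hd 1).fun_mul (hd 1)),
    pderiv_mul (hd 0) (hd 0), pderiv_mul (hd 1) (hd 1)] at h1
  have hconst : pderiv i (fun _ => (1 : ℝ)) x = 0 := by simp [pderiv]
  rw [hconst] at h1
  have hs := tilt_sq_mul (hg x hx)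
  have hp := tilt_pos (hg x hx)
  generalize pderiv i (tilt u) x = d at *
  generalize pderiv i (pderiv 0 u) x = a at *
  generalize pderiv i (pderiv 1 u) x = b at *
  generalize pderiv 0 u x = p at *
  generalize pderiv 1 u x = q at *
  generalize tilt u x = w at *
  have : w * (2 * (d * (1 - (p ^ 2 + q ^ 2)) - w * (p * a + q * b))) = 0 := by linarith
  have h2 : d * (1 - (p ^ 2 + q ^ 2)) = w * (p * a + q * b) := by
    rcases mul_eq_zero.1 this with h | h
    · exact absurd h hp.ne'
    · linarith
  calc d = d * (w ^ 2 * (1 - (p ^ 2 + q ^ 2))) := by rw [hs, mul_one]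
    _ = w ^ 2 * (d * (1 - (p ^ 2 + q ^ 2))) := by ring
    _ = _ := by rw [h2]; ring

lemma lorentzMeanCurv_eq (x : EuclideanSpace ℝ (Fin 2)) :
    lorentzMeanCurv u x = ∑ i, pderiv i (fun y => tilt u y * pderiv i u y) x := by
  simp only [lorentzMeanCurv, gradient_apply_eq_pderiv]

lemma lorentzMeanCurv_eq_second_order (hU : IsOpen U) (hu : ContDiffOn ℝ 2 u U)
    (hg : ∀ x ∈ U, ‖gradient u x‖ < 1) (hx : x ∈ U) :
    lorentzMeanCurv u x = tilt u x * (pderiv 0 (pderiv 0 u) x + pderiv 1 (pderiv 1 u) x) +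
      tilt u x ^ 3 * (pderiv 0 u x * (pderiv 0 u x * pderiv 0 (pderiv 0 u) x +
          pderiv 1 u x * pderiv 1 (pderiv 0 u) x) +
        pderiv 1 u x * (pderiv 0 u x * pderiv 1 (pderiv 0 u) x +
          pderiv 1 u x * pderiv 1 (pderiv 1 u) x)) := by
  have hw : DifferentiableAt ℝ (tilt u) x :=
    (contDiffOn_tilt hU hu (m := 1) (by norm_num) hg).differentiableAt_of_isOpen hU hx
  have hd : ∀ j, DifferentiableAt ℝ (pderiv j u) x := fun j =>
    (contDiffOn_pderiv hU hu (m := 1) (by norm_num)).differentiableAt_of_isOpen hU hx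
  rw [lorentzMeanCurv_eq, Fin.sum_univ_two, pderiv_mul hw (hd 0), pderiv_mul hw (hd 1),
    pderiv_tilt hU hu hg hx, pderiv_tilt hU hu hg hx, pderiv_comm hU hu hx 0 1]
  ring

end Calculus

section CurvatureEnergy

variable {U K : Set (EuclideanSpace ℝ (Fin 2))} {u η ρ : EuclideanSpace ℝ (Fin 2) → ℝ}

/-- The `i`-th component of `D²u Du`. -/
def hessGrad (u : EuclideanSpace ℝ (Fin 2) → ℝ) (i : Fin 2) (x : EuclideanSpace ℝ (Fin 2)) : ℝ :=
  pderiv 0 u x * pderiv i (pderiv 0 u) x + pderiv 1 u x * pderiv i (pderiv 1 u) x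

/-- The density `w |D²u|² + w³ |D²u Du|²`. -/
def curvatureEnergy (u : EuclideanSpace ℝ (Fin 2) → ℝ) (x : EuclideanSpace ℝ (Fin 2)) : ℝ :=
  tilt u x * (pderiv 0 (pderiv 0 u) x ^ 2 + 2 * pderiv 0 (pderiv 1 u) x ^ 2 +
    pderiv 1 (pderiv 1 u) x ^ 2) + tilt u x ^ 3 * (hessGrad u 0 x ^ 2 + hessGrad u 1 x ^ 2)

lemma curvatureEnergy_nonneg (x : EuclideanSpace ℝ (Fin 2)) : 0 ≤ curvatureEnergy u x := by
  have := tilt_nonneg (u := u) (x := x)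
  unfold curvatureEnergy
  positivity

lemma continuousOn_curvatureEnergy (hU : IsOpen U) (hu : ContDiffOn ℝ 3 u U)
    (hg : ∀ x ∈ U, ‖gradient u x‖ < 1) : ContinuousOn (curvatureEnergy u) U := by
  have hw : ContinuousOn (tilt u) U :=
    (contDiffOn_tilt hU hu (m := 1) (by norm_num) hg).continuousOn
  have h1 : ∀ i, ContDiffOn ℝ 2 (pderiv i u) U := fun i => contDiffOn_pderiv hU hu (by norm_num)
  have h1c : ∀ i, ContinuousOn (pderiv i u) U := fun i => (h1 i).continuousOn
  have h2 : ∀ i j, ContinuousOn (pderiv j (pderiv i u)) U := fun i j =>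
    (contDiffOn_pderiv hU (h1 i) (m := 1) (by norm_num)).continuousOn
  unfold curvatureEnergy hessGrad
  fun_prop

lemma mul_curvatureEnergy_identity (hU : IsOpen U) (hK : IsCompact K) (hKU : K ⊆ U)
    (hu : ContDiffOn ℝ 3 u U) (hg : ∀ x ∈ U, ‖gradient u x‖ < 1) (hη : ContDiff ℝ 1 η)
    (hη0 : ∀ x ∉ K, η x = 0) :
    ∫ x in K, (η x ^ 2 * (curvatureEnergy u x - lorentzMeanCurv u x *
        (pderiv 0 (pderiv 0 u) x + pderiv 1 (pderiv 1 u) x)) +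
      2 * η x * tilt u x *
        (pderiv 0 η x * (pderiv 1 u x * pderiv 0 (pderiv 1 u) x -
            pderiv 0 u x * pderiv 1 (pderiv 1 u) x) +
          pderiv 1 η x * (pderiv 0 u x * pderiv 0 (pderiv 1 u) x -
            pderiv 1 u x * pderiv 0 (pderiv 0 u) x))) = 0 := by
  have hu2 : ContDiffOn ℝ 2 u U := hu.of_le (by norm_num)
  have hw : ContDiffOn ℝ 1 (tilt u) U := contDiffOn_tilt hU hu (by norm_num) hg
  have h1 : ∀ i, ContDiffOn ℝ 2 (pderiv i u) U := fun i => contDiffOn_pderiv hU hu (by norm_num)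
  have h1' : ∀ i, ContDiffOn ℝ 1 (pderiv i u) U := fun i => (h1 i).of_le (by norm_num)
  have h2 : ∀ i j, ContDiffOn ℝ 1 (pderiv j (pderiv i u)) U := fun i j =>
    contDiffOn_pderiv hU (h1 i) (by norm_num)
  have hη' : ContDiffOn ℝ 1 η U := hη.contDiffOn
  set T : Fin 2 → EuclideanSpace ℝ (Fin 2) → ℝ := fun i x => (η x * η x) * (tilt u x *
    (pderiv (1 - i) u x * pderiv 0 (pderiv 1 u) x -
      pderiv i u x * pderiv (1 - i) (pderiv (1 - i) u) x)) with hT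
  have hTs : ∀ i, ContDiffOn ℝ 1 (T i) U := fun i =>
    (hη'.mul hη').mul (hw.mul (((h1' _).mul (h2 _ _)).sub ((h1' _).mul (h2 _ _))))
  have hT0 : ∀ i, ∀ x ∈ U, x ∉ K → T i x = 0 := fun i x _ hx => by simp [hT, hη0 x hx]
  have hTi : ∀ i, IntegrableOn (pderiv i (T i)) K := fun i =>
    ((contDiffOn_pderiv hU (hTs i) (m := 0) (by norm_num)).continuousOn.mono hKU
      ).integrableOn_compact hK
  have hsum : ∫ x in K, (pderiv 0 (T 0) x + pderiv 1 (T 1) x) = 0 := by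
    rw [integral_add (hTi 0) (hTi 1), setIntegral_compact_pderiv_eq_zero hU hK hKU (hTs 0) (hT0 0),
      setIntegral_compact_pderiv_eq_zero hU hK hKU (hTs 1) (hT0 1), add_zero]
  rw [← hsum]
  refine setIntegral_congr_fun hK.measurableSet fun x hxK => ?_
  have hx := hKU hxK
  have dη := hη'.differentiableAt_of_isOpen hU hx
  have dw := hw.differentiableAt_of_isOpen hU hx
  have d1 : ∀ i, DifferentiableAt ℝ (pderiv i u) x := fun i =>
    (h1' i).differentiableAt_of_isOpen hU hx
  have d2 : ∀ i j, DifferentiableAt ℝ (pderiv j (pderiv i u)) x := fun i j =>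
    (h2 i j).differentiableAt_of_isOpen hU hx
  have hdT : ∀ i, pderiv i (T i) x = (pderiv i η x * η x + η x * pderiv i η x) * (tilt u x *
      (pderiv (1 - i) u x * pderiv 0 (pderiv 1 u) x -
        pderiv i u x * pderiv (1 - i) (pderiv (1 - i) u) x)) +
      η x * η x * (pderiv i (tilt u) x * (pderiv (1 - i) u x * pderiv 0 (pderiv 1 u) x -
        pderiv i u x * pderiv (1 - i) (pderiv (1 - i) u) x) + tilt u x *
        ((pderiv i (pderiv (1 - i) u) x * pderiv 0 (pderiv 1 u) x +
          pderiv (1 - i) u x * pderiv i (pderiv 0 (pderiv 1 u)) x) -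
        (pderiv i (pderiv i u) x * pderiv (1 - i) (pderiv (1 - i) u) x +
          pderiv i u x * pderiv i (pderiv (1 - i) (pderiv (1 - i) u)) x))) := by
    intro i
    have e1 := (d1 (1 - i)).fun_mul (d2 1 0)
    have e2 := (d1 i).fun_mul (d2 (1 - i) (1 - i))
    simp only [hT]
    rw [pderiv_mul (dη.fun_mul dη) (dw.fun_mul (e1.fun_sub e2)), pderiv_mul dη dη,
      pderiv_mul dw (e1.fun_sub e2), pderiv_sub e1 e2, pderiv_mul (d1 _) (d2 _ _),
      pderiv_mul (d1 _) (d2 _ _)]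
  have s1 : pderiv 1 (pderiv 0 u) x = pderiv 0 (pderiv 1 u) x := pderiv_comm hU hu2 hx 1 0
  have s2 : pderiv 0 (pderiv 1 (pderiv 1 u)) x = pderiv 1 (pderiv 0 (pderiv 1 u)) x :=
    pderiv_comm hU (h1 1) hx 0 1
  have s3 : pderiv 1 (pderiv 0 (pderiv 0 u)) x = pderiv 0 (pderiv 0 (pderiv 1 u)) x := by
    rw [pderiv_comm hU (h1 0) hx 1 0]
    have : pderiv 1 (pderiv 0 u) =ᶠ[𝓝 x] pderiv 0 (pderiv 1 u) := by
      filter_upwards [hU.mem_nhds hx] with y hy using pderiv_comm hU hu2 hy 1 0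
    rw [pderiv, this.fderiv_eq, ← pderiv]
  simp only [hdT]
  simp only [sub_zero, sub_self, pderiv_tilt hU hu2 hg hx, s1, s2, s3, curvatureEnergy, hessGrad,
    lorentzMeanCurv_eq_second_order hU hu2 hg hx]
  ring

lemma sq_le_of_abs_sub_le {H r L w : ℝ} (h : |H - r| ≤ L * w) :
    H ^ 2 ≤ 2 * r ^ 2 + 2 * L ^ 2 * w ^ 2 := by
  have : (H - r) ^ 2 ≤ (L * w) ^ 2 := sq_le_sq' (by linarith [neg_abs_le (H - r)])
    ((le_abs_self _).trans h)
  nlinarith [sq_nonneg (H - 2 * r)]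

lemma curvatureEnergy_pointwise_bound {η d0 d1 w p q a b c Q H r L N : ℝ} (hw : 1 ≤ w)
    (hη0 : 0 ≤ η) (hη1 : η ≤ 1) (hpq : p ^ 2 + q ^ 2 ≤ 1)
    (hQ : w * (a ^ 2 + 2 * b ^ 2 + c ^ 2) ≤ Q) (hd : d0 ^ 2 + d1 ^ 2 ≤ N) (hH : |H - r| ≤ L * w) :
    η ^ 2 * Q ≤ 2 * (η ^ 2 * (Q - H * (a + c)) +
      2 * η * w * (d0 * (q * b - p * c) + d1 * (p * b - q * a))) +
      (8 * r ^ 2 + 8 * (L ^ 2 + N) * w) := by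
  have hw0 : 0 < w := by linarith
  have hη2 : η ^ 2 ≤ 1 := by nlinarith
  have h1 : H * (a + c) ≤ Q / 4 + (4 * r ^ 2 + 4 * L ^ 2 * w) := by
    have e1 : 2 * H ^ 2 / w ≤ 4 * r ^ 2 + 4 * L ^ 2 * w := by
      rw [div_le_iff₀ hw0]
      nlinarith [sq_le_of_abs_sub_le hH, mul_nonneg (sq_nonneg r) (by linarith : 0 ≤ w - 1)]
    have e2 : H * (a + c) ≤ w * (a + c) ^ 2 / 8 + 2 * H ^ 2 / w := by
      have : w * (a + c) ^ 2 / 8 + 2 * H ^ 2 / w - H * (a + c) =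
        (w * (a + c) - 4 * H) ^ 2 / (8 * w) := by field_simp; ring
      have := div_nonneg (sq_nonneg (w * (a + c) - 4 * H)) (by linarith : 0 ≤ 8 * w)
      linarith
    have e3 : w * (a + c) ^ 2 ≤ 2 * (w * (a ^ 2 + 2 * b ^ 2 + c ^ 2)) := by
      nlinarith [mul_nonneg hw0.le (sq_nonneg (a - c)), mul_nonneg hw0.le (sq_nonneg b)]
    linarith
  have h2 : -(2 * η * w * (d0 * (q * b - p * c) + d1 * (p * b - q * a))) ≤
      η ^ 2 * Q / 4 + 4 * N * w := by
    have e1 : (q * b - p * c) ^ 2 + (p * b - q * a) ^ 2 ≤ a ^ 2 + 2 * b ^ 2 + c ^ 2 := by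
      nlinarith [sq_nonneg (p * b + q * c), sq_nonneg (q * b + p * a),
        mul_nonneg (by linarith : 0 ≤ 1 - (p ^ 2 + q ^ 2))
          (by positivity : 0 ≤ a ^ 2 + 2 * b ^ 2 + c ^ 2)]
    have e2 : -(2 * η * (d0 * (q * b - p * c) + d1 * (p * b - q * a))) ≤
        η ^ 2 * ((q * b - p * c) ^ 2 + (p * b - q * a) ^ 2) / 4 + 4 * (d0 ^ 2 + d1 ^ 2) := by
      nlinarith [sq_nonneg (η * (q * b - p * c) / 2 + 2 * d0),
        sq_nonneg (η * (p * b - q * a) / 2 + 2 * d1)]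
    have e3 := mul_le_mul_of_nonneg_left e1 (sq_nonneg η)
    have e4 := mul_le_mul_of_nonneg_left (show -(2 * η * (d0 * (q * b - p * c) +
      d1 * (p * b - q * a))) ≤ η ^ 2 * (a ^ 2 + 2 * b ^ 2 + c ^ 2) / 4 + 4 * N by linarith) hw0.le
    have e5 := mul_le_mul_of_nonneg_left hQ (sq_nonneg η)
    nlinarith
  have h3 := mul_le_mul_of_nonneg_left h1 (sq_nonneg η)
  have h4 : η ^ 2 * (4 * r ^ 2 + 4 * L ^ 2 * w) ≤ 1 * (4 * r ^ 2 + 4 * L ^ 2 * w) :=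
    mul_le_mul_of_nonneg_right hη2 (by positivity)
  linarith

/-- Local weighted `L²` bound for the second fundamental form. -/
lemma setIntegral_curvatureEnergy_le (hU : IsOpen U) (hK : IsCompact K) (hKU : K ⊆ U)
    (hu : ContDiffOn ℝ 3 u U) (hg : ∀ x ∈ U, ‖gradient u x‖ < 1) (hη : ContDiff ℝ 1 η)
    (hη0 : ∀ x ∉ K, η x = 0) (hη01 : ∀ x, η x ∈ Icc (0 : ℝ) 1) {N Λ : ℝ}
    (hN : ∀ x, pderiv 0 η x ^ 2 + pderiv 1 η x ^ 2 ≤ N) (hρ : ContinuousOn ρ U)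
    (hH : ∀ x ∈ U, |lorentzMeanCurv u x - ρ x| ≤ Λ * tilt u x) :
    ∫ x in K, η x ^ 2 * curvatureEnergy u x ≤
      8 * (∫ x in K, ρ x ^ 2) + 8 * (Λ ^ 2 + N) * ∫ x in K, tilt u x := by
  have hid := mul_curvatureEnergy_identity hU hK hKU hu hg hη hη0
  have hu2 : ContDiffOn ℝ 2 u U := hu.of_le (by norm_num)
  have hw : ContinuousOn (tilt u) U :=
    (contDiffOn_tilt hU hu (m := 1) (by norm_num) hg).continuousOn
  have hQ := continuousOn_curvatureEnergy hU hu hg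
  have h1 : ∀ i, ContDiffOn ℝ 2 (pderiv i u) U := fun i => contDiffOn_pderiv hU hu (by norm_num)
  have h1c : ∀ i, ContinuousOn (pderiv i u) U := fun i => (h1 i).continuousOn
  have h2 : ∀ i j, ContinuousOn (pderiv j (pderiv i u)) U := fun i j =>
    (contDiffOn_pderiv hU (h1 i) (m := 1) (by norm_num)).continuousOn
  have hHc : ContinuousOn (lorentzMeanCurv u) U := by
    refine ContinuousOn.congr ?_ fun x hx => lorentzMeanCurv_eq_second_order hU hu2 hg hx
    fun_prop
  have hηc : ContinuousOn η U := hη.continuous.continuousOn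
  have hdη : ∀ i, ContinuousOn (pderiv i η) U := fun i => (continuous_pderiv hη).continuousOn
  have hint : ∀ {F : EuclideanSpace ℝ (Fin 2) → ℝ}, ContinuousOn F U → IntegrableOn F K :=
    fun hF => (hF.mono hKU).integrableOn_compact hK
  have hρi : IntegrableOn (fun x => 8 * ρ x ^ 2) K := hint (by fun_prop)
  have hwi : IntegrableOn (fun x => 8 * (Λ ^ 2 + N) * tilt u x) K := hint (by fun_prop)
  set J : EuclideanSpace ℝ (Fin 2) → ℝ := fun x =>
    η x ^ 2 * (curvatureEnergy u x - lorentzMeanCurv u x *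
        (pderiv 0 (pderiv 0 u) x + pderiv 1 (pderiv 1 u) x)) +
      2 * η x * tilt u x *
        (pderiv 0 η x * (pderiv 1 u x * pderiv 0 (pderiv 1 u) x -
            pderiv 0 u x * pderiv 1 (pderiv 1 u) x) +
          pderiv 1 η x * (pderiv 0 u x * pderiv 0 (pderiv 1 u) x -
            pderiv 1 u x * pderiv 0 (pderiv 0 u) x))
  have hJ : ContinuousOn (fun x => 2 * J x) U := by fun_prop
  have hR : ContinuousOn (fun x => 8 * ρ x ^ 2 + 8 * (Λ ^ 2 + N) * tilt u x) U := by fun_prop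
  calc ∫ x in K, η x ^ 2 * curvatureEnergy u x
      ≤ ∫ x in K, (2 * J x + (8 * ρ x ^ 2 + 8 * (Λ ^ 2 + N) * tilt u x)) := by
        refine setIntegral_mono_on (hint (by fun_prop)) (hint (hJ.add hR)) hK.measurableSet
          fun x hxK => ?_
        have hx := hKU hxK
        refine curvatureEnergy_pointwise_bound (one_le_tilt (hg x hx)) (hη01 x).1 (hη01 x).2
          (sq_add_sq_lt_one (hg x hx)).le ?_ (hN x) (hH x hx)
        have := tilt_nonneg (u := u) (x := x)
        unfold curvatureEnergy
        exact le_add_of_nonneg_right (by positivity)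
    _ = _ := by
        rw [integral_add (hint hJ) (hint hR), integral_const_mul, hid, integral_add hρi hwi,
          integral_const_mul, integral_const_mul]
        ring

end CurvatureEnergy

section LogEstimate

variable {U K : Set (EuclideanSpace ℝ (Fin 2))} {u η ρ : EuclideanSpace ℝ (Fin 2) → ℝ}
  {x : EuclideanSpace ℝ (Fin 2)}

lemma sq_hessGrad_le (i : Fin 2) : tilt u x ^ 3 * hessGrad u i x ^ 2 ≤ curvatureEnergy u x := by
  have := tilt_nonneg (u := u) (x := x)
  have h : tilt u x ^ 3 * hessGrad u i x ^ 2 ≤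
      tilt u x ^ 3 * (hessGrad u 0 x ^ 2 + hessGrad u 1 x ^ 2) := by
    refine mul_le_mul_of_nonneg_left ?_ (by positivity)
    fin_cases i <;> simp [sq_nonneg]
  refine h.trans ?_
  unfold curvatureEnergy
  exact le_add_of_nonneg_left (by positivity)

lemma mul_sq_mul_abs_hessGrad_le (hw : 1 ≤ tilt u x) (t : ℝ) (i : Fin 2) :
    t * (tilt u x ^ 2 * |hessGrad u i x|) ≤ (tilt u x + t ^ 2 * curvatureEnergy u x) / 2 := by
  have h := mul_le_mul_of_nonneg_left (sq_hessGrad_le (u := u) (x := x) i) (sq_nonneg t)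
  have e : tilt u x * (1 - t * (tilt u x * |hessGrad u i x|)) ^ 2 =
      tilt u x + t ^ 2 * (tilt u x ^ 3 * hessGrad u i x ^ 2) -
        2 * (t * (tilt u x ^ 2 * |hessGrad u i x|)) := by
    rw [← sq_abs (hessGrad u i x)]; ring
  have := mul_nonneg (by linarith : 0 ≤ tilt u x) (sq_nonneg (1 - t * (tilt u x * |hessGrad u i x|)))
  linarith

lemma pderiv_mul_log_tilt (hU : IsOpen U) (hu : ContDiffOn ℝ 2 u U)
    (hg : ∀ x ∈ U, ‖gradient u x‖ < 1) (hη : ContDiff ℝ 1 η) (hx : x ∈ U) (i : Fin 2) :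
    pderiv i (fun y => η y * Real.log (1 + tilt u y)) x =
      pderiv i η x * Real.log (1 + tilt u x) +
        η x * ((1 + tilt u x)⁻¹ * (tilt u x ^ 3 * hessGrad u i x)) := by
  have hw : DifferentiableAt ℝ (tilt u) x :=
    (contDiffOn_tilt hU hu (m := 1) (by norm_num) hg).differentiableAt_of_isOpen hU hx
  have hp := tilt_nonneg (u := u) (x := x)
  have hl : HasDerivAt (fun s => Real.log (1 + s)) (1 + tilt u x)⁻¹ (tilt u x) := by
    simpa using ((hasDerivAt_id (tilt u x)).const_add 1).log (by simp; positivity)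
  have hd : DifferentiableAt ℝ (fun y => Real.log (1 + tilt u y)) x :=
    (hw.const_add 1).log (by positivity)
  rw [pderiv_mul (hη.differentiable one_ne_zero x) hd, pderiv_comp hl hw, pderiv_tilt hU hu hg hx,
    hessGrad]

lemma abs_pderiv_mul_log_tilt_le (hU : IsOpen U) (hu : ContDiffOn ℝ 2 u U)
    (hg : ∀ x ∈ U, ‖gradient u x‖ < 1) (hη : ContDiff ℝ 1 η) (hx : x ∈ U) (hη0 : 0 ≤ η x)
    {A : ℝ} (hA : ∀ i, |pderiv i η x| ≤ A) (i : Fin 2) :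
    |pderiv i (fun y => η y * Real.log (1 + tilt u y)) x| ≤
      (A + 1) * tilt u x + η x ^ 2 * curvatureEnergy u x := by
  rw [pderiv_mul_log_tilt hU hu hg hη hx]
  have hw := one_le_tilt (hg x hx)
  have h0 : 0 ≤ tilt u x := by linarith
  have hQ := mul_nonneg (sq_nonneg (η x)) (curvatureEnergy_nonneg (u := u) x)
  have hl0 : 0 ≤ Real.log (1 + tilt u x) := Real.log_nonneg (by linarith)
  have hl : Real.log (1 + tilt u x) ≤ tilt u x := by
    linarith [Real.log_le_sub_one_of_pos (by linarith : 0 < 1 + tilt u x)]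
  have h1 : |pderiv i η x * Real.log (1 + tilt u x)| ≤ A * tilt u x := by
    rw [abs_mul, abs_of_nonneg hl0]
    exact mul_le_mul (hA i) hl hl0 ((abs_nonneg _).trans (hA i))
  have h2 : |η x * ((1 + tilt u x)⁻¹ * (tilt u x ^ 3 * hessGrad u i x))| ≤
      η x * (tilt u x ^ 2 * |hessGrad u i x|) := by
    rw [abs_mul, abs_of_nonneg hη0, abs_mul, abs_mul,
      abs_of_nonneg (by positivity : 0 ≤ (1 + tilt u x)⁻¹),
      abs_of_nonneg (by positivity : 0 ≤ tilt u x ^ 3)]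
    refine mul_le_mul_of_nonneg_left ?_ hη0
    rw [inv_mul_le_iff₀ (by linarith)]
    nlinarith [mul_nonneg (sq_nonneg (tilt u x)) (abs_nonneg (hessGrad u i x))]
  have h3 := mul_sq_mul_abs_hessGrad_le hw (η x) i
  have h4 := abs_add_le (pderiv i η x * Real.log (1 + tilt u x))
    (η x * ((1 + tilt u x)⁻¹ * (tilt u x ^ 3 * hessGrad u i x)))
  linarith

lemma sum_pderiv_mul_tilt (hU : IsOpen U) (hu : ContDiffOn ℝ 2 u U)
    (hg : ∀ x ∈ U, ‖gradient u x‖ < 1) {f : EuclideanSpace ℝ (Fin 2) → ℝ}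
    (hf : DifferentiableAt ℝ f x) (hx : x ∈ U) :
    ∑ i, pderiv i (fun y => f y * (tilt u y * pderiv i u y)) x =
      f x * lorentzMeanCurv u x +
        tilt u x * (pderiv 0 u x * pderiv 0 f x + pderiv 1 u x * pderiv 1 f x) := by
  have hw : DifferentiableAt ℝ (tilt u) x :=
    (contDiffOn_tilt hU hu (m := 1) (by norm_num) hg).differentiableAt_of_isOpen hU hx
  have hd : ∀ j, DifferentiableAt ℝ (pderiv j u) x := fun j =>
    (contDiffOn_pderiv hU hu (m := 1) (by norm_num)).differentiableAt_of_isOpen hU hx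
  rw [lorentzMeanCurv_eq, Fin.sum_univ_two, Fin.sum_univ_two, pderiv_mul hf (hw.fun_mul (hd 0)),
    pderiv_mul hf (hw.fun_mul (hd 1))]
  ring

lemma abs_sum_pderiv_mul_tilt_le (hU : IsOpen U) (hu : ContDiffOn ℝ 2 u U)
    (hg : ∀ x ∈ U, ‖gradient u x‖ < 1) (hη : ContDiff ℝ 1 η) (hx : x ∈ U)
    (hη01 : η x ∈ Icc (0 : ℝ) 1) {A Λ : ℝ} (hA : ∀ i, |pderiv i η x| ≤ A)
    (hH : |lorentzMeanCurv u x - ρ x| ≤ Λ * tilt u x) (k : Fin 2) :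
    |∑ i, pderiv i (fun y => η y * pderiv k u y * (tilt u y * pderiv i u y)) x| ≤
      ρ x ^ 2 + (2 + Λ + 2 * A) * tilt u x + η x ^ 2 * curvatureEnergy u x := by
  have hd : ∀ j, DifferentiableAt ℝ (pderiv j u) x := fun j =>
    (contDiffOn_pderiv hU hu (m := 1) (by norm_num)).differentiableAt_of_isOpen hU hx
  have dη := hη.differentiable one_ne_zero x
  rw [sum_pderiv_mul_tilt hU hu hg (dη.fun_mul (hd k)) hx, pderiv_mul dη (hd k),
    pderiv_mul dη (hd k)]
  have hw := one_le_tilt (hg x hx)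
  have h0 : 0 ≤ tilt u x := by linarith
  have hQ := mul_nonneg (sq_nonneg (η x)) (curvatureEnergy_nonneg (u := u) x)
  have hpq := (sq_add_sq_lt_one (hg x hx)).le
  have hp : ∀ j, |pderiv j u x| ≤ 1 := Fin.forall_fin_two.2
    ⟨(sq_le_one_iff_abs_le_one _).1 (by linarith [sq_nonneg (pderiv 1 u x)]),
      (sq_le_one_iff_abs_le_one _).1 (by linarith [sq_nonneg (pderiv 0 u x)])⟩
  have hv : pderiv 0 u x * pderiv 0 (pderiv k u) x + pderiv 1 u x * pderiv 1 (pderiv k u) x =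
      hessGrad u k x := by
    rw [hessGrad, pderiv_comm hU hu hx 0 k, pderiv_comm hU hu hx 1 k]
  have e : η x * pderiv k u x * lorentzMeanCurv u x + tilt u x *
      (pderiv 0 u x * (pderiv 0 η x * pderiv k u x + η x * pderiv 0 (pderiv k u) x) +
        pderiv 1 u x * (pderiv 1 η x * pderiv k u x + η x * pderiv 1 (pderiv k u) x)) =
      η x * pderiv k u x * lorentzMeanCurv u x + tilt u x * (pderiv k u x *
        (pderiv 0 u x * pderiv 0 η x + pderiv 1 u x * pderiv 1 η x)) +
      η x * (tilt u x * hessGrad u k x) := by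
    rw [← hv]; ring
  rw [e]
  have hHb : |lorentzMeanCurv u x| ≤ ρ x ^ 2 + (1 + Λ) * tilt u x := by
    have h1 := abs_sub_abs_le_abs_sub (lorentzMeanCurv u x) (ρ x)
    have h2 : |ρ x| ≤ ρ x ^ 2 + 1 := by
      nlinarith [sq_abs (ρ x), sq_nonneg (|ρ x| - 1), abs_nonneg (ρ x)]
    linarith
  have h1 : |η x * pderiv k u x * lorentzMeanCurv u x| ≤ ρ x ^ 2 + (1 + Λ) * tilt u x := by
    rw [abs_mul, abs_mul, abs_of_nonneg hη01.1]
    have : η x * |pderiv k u x| ≤ 1 := mul_le_one₀ hη01.2 (abs_nonneg _) (hp k)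
    exact (mul_le_of_le_one_left (abs_nonneg _) this).trans hHb
  have h2 : |tilt u x * (pderiv k u x *
      (pderiv 0 u x * pderiv 0 η x + pderiv 1 u x * pderiv 1 η x))| ≤ 2 * A * tilt u x := by
    have hj : ∀ j, |pderiv j u x * pderiv j η x| ≤ A := fun j => by
      rw [abs_mul]
      exact (mul_le_of_le_one_left (abs_nonneg _) (hp j)).trans (hA j)
    have hs := (abs_add_le (pderiv 0 u x * pderiv 0 η x) (pderiv 1 u x * pderiv 1 η x)).trans
      (add_le_add (hj 0) (hj 1))
    rw [abs_mul, abs_mul, abs_of_nonneg h0]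
    have := (mul_le_of_le_one_left (abs_nonneg _) (hp k)).trans hs
    nlinarith [mul_le_mul_of_nonneg_left this h0]
  have h3 : |η x * (tilt u x * hessGrad u k x)| ≤ η x * (tilt u x ^ 2 * |hessGrad u k x|) := by
    rw [abs_mul, abs_mul, abs_of_nonneg h0, abs_of_nonneg hη01.1]
    refine mul_le_mul_of_nonneg_left (mul_le_mul_of_nonneg_right ?_ (abs_nonneg _)) hη01.1
    nlinarith
  have h4 := mul_sq_mul_abs_hessGrad_le hw (η x) k
  have h5 := abs_add_three (η x * pderiv k u x * lorentzMeanCurv u x) (tilt u x * (pderiv k u x *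
    (pderiv 0 u x * pderiv 0 η x + pderiv 1 u x * pderiv 1 η x))) (η x * (tilt u x * hessGrad u k x))
  linarith

lemma tilt_mul_log_le (h : ‖gradient u x‖ < 1) :
    tilt u x * Real.log (1 + tilt u x) ≤
      Real.log (1 + tilt u x) * (pderiv 0 u x * (tilt u x * pderiv 0 u x) +
        pderiv 1 u x * (tilt u x * pderiv 1 u x)) + 1 := by
  have hw := one_le_tilt h
  have hs := tilt_sq_mul h
  have hl : Real.log (1 + tilt u x) ≤ tilt u x := by
    linarith [Real.log_le_sub_one_of_pos (by linarith : 0 < 1 + tilt u x)]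
  have h1 := sq_add_sq_lt_one h
  have : Real.log (1 + tilt u x) * (tilt u x * (1 - (pderiv 0 u x ^ 2 + pderiv 1 u x ^ 2))) ≤
      tilt u x * (tilt u x * (1 - (pderiv 0 u x ^ 2 + pderiv 1 u x ^ 2))) :=
    mul_le_mul_of_nonneg_right hl (mul_nonneg (by linarith) (by linarith))
  nlinarith

/-- Local `w log (1 + w)` estimate, in terms of local bounds for the integrals of `w` and `ρ²`. -/
lemma setIntegral_tilt_mul_log_le (hU : IsOpen U) (hK : IsCompact K) (hKU : K ⊆ U)
    (hu : ContDiffOn ℝ 3 u U) (hg : ∀ x ∈ U, ‖gradient u x‖ < 1) (hη : ContDiff ℝ 1 η)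
    (hη0 : ∀ x ∉ K, η x = 0) (hη01 : ∀ x, η x ∈ Icc (0 : ℝ) 1) {A Λ W P : ℝ} (hΛ : 0 ≤ Λ)
    (hA : ∀ i x, |pderiv i η x| ≤ A) (hρ : ContinuousOn ρ U)
    (hH : ∀ x ∈ U, |lorentzMeanCurv u x - ρ x| ≤ Λ * tilt u x)
    (hW : ∫ x in K, tilt u x ≤ W) (hP : ∫ x in K, ρ x ^ 2 ≤ P) :
    ∫ x in K, η x ^ 2 * (tilt u x * Real.log (1 + tilt u x)) ≤
      2 * (((A + 1) * W + (8 * P + 8 * (Λ ^ 2 + 2 * A ^ 2) * W)) *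
        (P + (2 + Λ + 2 * A) * W + (8 * P + 8 * (Λ ^ 2 + 2 * A ^ 2) * W))) + W := by
  have hA0 : 0 ≤ A := (abs_nonneg _).trans (hA 0 0)
  have hN : ∀ x, pderiv 0 η x ^ 2 + pderiv 1 η x ^ 2 ≤ 2 * A ^ 2 := fun x => by
    have h : ∀ i, pderiv i η x ^ 2 ≤ A ^ 2 := fun i => sq_le_sq.2 ((hA i x).trans (le_abs_self A))
    linarith [h 0, h 1]
  have hS := setIntegral_curvatureEnergy_le hU hK hKU hu hg hη hη0 hη01 hN hρ hH
  set S := 8 * P + 8 * (Λ ^ 2 + 2 * A ^ 2) * W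
  have hS' : ∫ x in K, η x ^ 2 * curvatureEnergy u x ≤ S := by
    refine hS.trans (add_le_add (by linarith) (mul_le_mul_of_nonneg_left hW (by positivity)))
  have hu2 : ContDiffOn ℝ 2 u U := hu.of_le (by norm_num)
  have hwd : ContDiffOn ℝ 1 (tilt u) U := contDiffOn_tilt hU hu (by norm_num) hg
  have h1 : ∀ i, ContDiffOn ℝ 1 (pderiv i u) U := fun i => contDiffOn_pderiv hU hu (by norm_num)
  have h1c : ∀ i, ContinuousOn (pderiv i u) U := fun i => (h1 i).continuousOn
  have hw := hwd.continuousOn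
  have hQ := continuousOn_curvatureEnergy hU hu hg
  have hηc : ContinuousOn η U := hη.continuous.continuousOn
  have hint : ∀ {F : EuclideanSpace ℝ (Fin 2) → ℝ}, ContinuousOn F U → IntegrableOn F K :=
    fun hF => (hF.mono hKU).integrableOn_compact hK
  have hw1 : ∀ x ∈ U, 1 ≤ tilt u x := fun x hx => one_le_tilt (hg x hx)
  set f : EuclideanSpace ℝ (Fin 2) → ℝ := fun y => η y * Real.log (1 + tilt u y) with hf
  have hlog : ContDiffOn ℝ 1 (fun y => Real.log (1 + tilt u y)) U :=
    (contDiffOn_const.add hwd).log fun x hx => by linarith [hw1 x hx]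
  have hlogc := hlog.continuousOn
  have hfd : ContDiffOn ℝ 1 f U := hη.contDiffOn.mul hlog
  have hfc := hfd.continuousOn
  set Y : Fin 2 → Fin 2 → EuclideanSpace ℝ (Fin 2) → ℝ := fun k i y =>
    η y * pderiv k u y * (tilt u y * pderiv i u y) with hY
  have hYd : ∀ k i, ContDiffOn ℝ 1 (Y k i) U := fun k i =>
    (hη.contDiffOn.mul (h1 k)).mul (hwd.mul (h1 i))
  have hYc : ∀ k i, ContinuousOn (Y k i) U := fun k i => (hYd k i).continuousOn
  have hdY : ∀ k i, ContinuousOn (pderiv i (Y k i)) U := fun k i =>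
    (contDiffOn_pderiv hU (hYd k i) (m := 0) (by norm_num)).continuousOn
  have hdf : ∀ i, ContinuousOn (pderiv i f) U := fun i =>
    (contDiffOn_pderiv hU hfd (m := 0) (by norm_num)).continuousOn
  have hb1 : ∀ i, ∫ x in K, |pderiv i f x| ≤ (A + 1) * W + S := fun i => by
    calc ∫ x in K, |pderiv i f x|
        ≤ ∫ x in K, ((A + 1) * tilt u x + η x ^ 2 * curvatureEnergy u x) :=
          setIntegral_mono_on (hint (hdf i).abs) (hint (by fun_prop)) hK.measurableSet fun x hx =>
            abs_pderiv_mul_log_tilt_le hU hu2 hg hη (hKU hx) (hη01 x).1 (fun i => hA i x) i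
      _ = (A + 1) * (∫ x in K, tilt u x) + ∫ x in K, η x ^ 2 * curvatureEnergy u x := by
          rw [integral_add (hint (by fun_prop)) (hint (by fun_prop)), integral_const_mul]
      _ ≤ _ := add_le_add (mul_le_mul_of_nonneg_left hW (by linarith)) hS'
  have hb2 : ∀ k, ∫ x in K, |∑ i, pderiv i (Y k i) x| ≤ P + (2 + Λ + 2 * A) * W + S := fun k => by
    have hc : ContinuousOn (fun x => |∑ i, pderiv i (Y k i) x|) U :=
      (continuousOn_finsetSum _ fun i _ => hdY k i).abs
    calc ∫ x in K, |∑ i, pderiv i (Y k i) x|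
        ≤ ∫ x in K, (ρ x ^ 2 + (2 + Λ + 2 * A) * tilt u x + η x ^ 2 * curvatureEnergy u x) :=
          setIntegral_mono_on (hint hc) (hint (by fun_prop)) hK.measurableSet fun x hx =>
            abs_sum_pderiv_mul_tilt_le hU hu2 hg hη (hKU hx) (hη01 x) (fun i => hA i x)
              (hH x (hKU hx)) k
      _ = (∫ x in K, ρ x ^ 2) + (2 + Λ + 2 * A) * (∫ x in K, tilt u x) +
            ∫ x in K, η x ^ 2 * curvatureEnergy u x := by
          rw [integral_add (hint (by fun_prop)) (hint (by fun_prop)),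
            integral_add (hint (by fun_prop)) (hint (by fun_prop)), integral_const_mul]
      _ ≤ _ := add_le_add (add_le_add hP (mul_le_mul_of_nonneg_left hW (by linarith))) hS'
  have hb : ∀ k, ∫ x in K, f x * Y k k x ≤
      ((A + 1) * W + S) * (P + (2 + Λ + 2 * A) * W + S) := fun k => by
    refine (setIntegral_compact_mul_le_of_div hU hK hKU k hfd (fun x _ hx => by simp [hf, hη0 x hx])
      (hYd k) (fun i x _ hx => by simp [hY, hη0 x hx]) fun x hx => ?_).trans ?_
    · have := mul_nonneg (mul_nonneg (hη01 x).1 (tilt_nonneg (u := u) (x := x)))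
        (sq_nonneg (pderiv k u x))
      simp only [hY]; linarith
    · exact mul_le_mul (hb1 _) (hb2 k) (integral_nonneg fun x => abs_nonneg _)
        ((integral_nonneg fun x => abs_nonneg _).trans (hb1 0))
  calc ∫ x in K, η x ^ 2 * (tilt u x * Real.log (1 + tilt u x))
      ≤ ∫ x in K, (f x * Y 0 0 x + f x * Y 1 1 x + tilt u x) := by
        refine setIntegral_mono_on (hint (by fun_prop)) (hint (by fun_prop)) hK.measurableSet
          fun x hxK => ?_
        have hx := hKU hxK
        have h := mul_le_mul_of_nonneg_left (tilt_mul_log_le (hg x hx)) (sq_nonneg (η x))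
        have h2 : η x ^ 2 ≤ 1 := pow_le_one₀ (hη01 x).1 (hη01 x).2
        have := hw1 x hx
        simp only [hf, hY]
        linarith
    _ = (∫ x in K, f x * Y 0 0 x) + (∫ x in K, f x * Y 1 1 x) + ∫ x in K, tilt u x := by
        rw [integral_add (hint (by fun_prop)) (hint (by fun_prop)),
          integral_add (hint (by fun_prop)) (hint (by fun_prop))]
    _ ≤ _ := by linarith [hb 0, hb 1]

end LogEstimate

section Cutoff

variable {U K : Set (EuclideanSpace ℝ (Fin 2))}

lemma abs_pderiv_le_norm_fderiv (F : EuclideanSpace ℝ (Fin 2) → ℝ) (i : Fin 2)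
    (x : EuclideanSpace ℝ (Fin 2)) : |pderiv i F x| ≤ ‖fderiv ℝ F x‖ := by
  simpa [pderiv] using (fderiv ℝ F x).le_opNorm (EuclideanSpace.single i 1)

lemma exists_cutoff (hU : IsOpen U) (hK : IsCompact K) (hKU : K ⊆ U) :
    ∃ (η : EuclideanSpace ℝ (Fin 2) → ℝ) (L : Set (EuclideanSpace ℝ (Fin 2))) (D : ℝ),
      ContDiff ℝ 1 η ∧ (∀ x, η x ∈ Icc (0 : ℝ) 1) ∧ (∀ x ∈ K, η x = 1) ∧ IsCompact L ∧ L ⊆ U ∧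
      (∀ x ∉ L, η x = 0) ∧ ∀ x, ‖fderiv ℝ η x‖ ≤ D := by
  obtain ⟨L, hL, hKL, hLU⟩ := exists_compact_between hK hU hKU
  obtain ⟨η, hη, hr, hs, h1⟩ := exists_contMDiff_support_eq_eq_one_iff
    (modelWithCornersSelf ℝ (EuclideanSpace ℝ (Fin 2))) (n := 1) isOpen_interior hK.isClosed hKL
  rw [contMDiff_iff_contDiff] at hη
  have h0 : ∀ x ∉ L, η x = 0 := fun x hx => by
    by_contra h
    exact hx (interior_subset (hs ▸ (Function.mem_support.2 h)))
  obtain ⟨D, hD⟩ := (hη.continuous_fderiv one_ne_zero).bounded_above_of_compact_support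
    ((HasCompactSupport.intro hL h0).fderiv ℝ)
  exact ⟨η, L, D, hη, fun x => hr (mem_range_self x), fun x hx => (h1 x).1 hx, hL, hLU, h0, hD⟩

lemma exists_exp_cutoff {k δ : ℝ} (hδ : 0 < δ) :
    ∃ f : ℝ → ℝ, ContDiff ℝ 1 f ∧ (∀ s ≤ δ, f s = 0) ∧ (∀ s, 0 ≤ f s) ∧
      (∀ s, k * f s ≤ deriv f s) ∧ ∀ s, 2 * δ ≤ s → f s = Real.exp (k * s) := by
  have hd : Differentiable ℝ Real.smoothTransition :=
    (Real.smoothTransition.contDiff (n := 1)).differentiable one_ne_zero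
  refine ⟨fun s => Real.exp (k * s) * Real.smoothTransition (s / δ - 1), ?_, fun s hs => ?_,
    fun s => mul_nonneg (Real.exp_pos _).le (Real.smoothTransition.nonneg _), fun s => ?_,
    fun s hs => ?_⟩
  · exact (contDiff_const.mul contDiff_id).exp.mul
      ((Real.smoothTransition.contDiff (n := 1)).comp ((contDiff_id.div_const δ).sub contDiff_const))
  · simp only
    rw [Real.smoothTransition.zero_of_nonpos, mul_zero]
    rw [sub_nonpos, div_le_one hδ]
    exact hs
  · have h1 : HasDerivAt (fun s => Real.exp (k * s)) (Real.exp (k * s) * k) s := by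
      simpa using ((hasDerivAt_id s).const_mul k).exp
    have h2 : HasDerivAt (fun s => Real.smoothTransition (s / δ - 1))
        (deriv Real.smoothTransition (s / δ - 1) * (1 / δ)) s :=
      (hd _).hasDerivAt.comp s (((hasDerivAt_id s).div_const δ).sub_const 1)
    rw [(h1.fun_mul h2).deriv]
    have := mul_nonneg (Real.exp_pos (k * s)).le (mul_nonneg
      (Real.smoothTransition.monotone.deriv_nonneg (x := s / δ - 1)) (by positivity : 0 ≤ 1 / δ))
    linarith
  · simp only
    rw [Real.smoothTransition.one_of_one_le, mul_one]
    rw [le_sub_iff_add_le, le_div_iff₀ hδ]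
    linarith

end Cutoff

section GlobalEnergy

variable {Ω : Set (EuclideanSpace ℝ (Fin 2))} {φ χ u ρ : EuclideanSpace ℝ (Fin 2) → ℝ}
  {θ Λ : ℝ} {x : EuclideanSpace ℝ (Fin 2)}

lemma setIntegral_le_of_lintegral_le {X : Type*} [MeasurableSpace X] {μ : Measure X} {s t : Set X}
    (hst : s ⊆ t) {f : X → ℝ} (hf : ∀ x, 0 ≤ f x) (hfm : AEStronglyMeasurable f (μ.restrict s)) {c : ℝ}
    (hc : 0 ≤ c) (h : ∫⁻ x in t, ENNReal.ofReal (f x) ∂μ ≤ ENNReal.ofReal c) :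
    ∫ x in s, f x ∂μ ≤ c := by
  rw [integral_eq_lintegral_of_nonneg_ae (Filter.Eventually.of_forall hf) hfm]
  exact ENNReal.toReal_le_of_le_ofReal hc ((lintegral_mono_set hst).trans h)

lemma setIntegral_const_le {s t : Set (EuclideanSpace ℝ (Fin 2))} (hst : s ⊆ t)
    (ht : Bornology.IsBounded t) {c : ℝ} (hc : 0 ≤ c) :
    ∫ _ in s, c ≤ c * volume.real t := by
  rw [setIntegral_const, smul_eq_mul, mul_comm]
  exact mul_le_mul_of_nonneg_left (measureReal_mono hst ht.measure_lt_top.ne) hc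

lemma exists_mem_frontier_segment_subset (hΩo : IsOpen Ω) (hΩb : Bornology.IsBounded Ω)
    (hx : x ∈ Ω) : ∃ y ∈ frontier Ω, ∃ r, x ∈ closedBall x r ∧ y ∈ closedBall x r ∧
      closedBall x r ⊆ closure Ω := by
  have hne : Ω ≠ univ := fun h => NormedSpace.unbounded_univ ℝ _ (h ▸ hΩb)
  obtain ⟨y, hy, hd⟩ := exists_mem_frontier_infDist_compl_eq_dist hx hne
  have hxy : x ≠ y := fun h => by
    rw [hΩo.frontier_eq] at hy
    exact hy.2 (h ▸ hx)
  refine ⟨y, hy, dist x y, mem_closedBall_self dist_nonneg, by simp [dist_comm], ?_⟩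
  rw [← closure_ball x (dist_ne_zero.2 hxy), ← hd]
  exact closure_mono ball_infDist_compl_subset

lemma abs_sub_le_of_eq_on_frontier (hΩo : IsOpen Ω) (hΩb : Bornology.IsBounded Ω)
    (hu : ∀ x ∈ closure Ω, DifferentiableAt ℝ u x) (hφ : ∀ x ∈ closure Ω, DifferentiableAt ℝ φ x)
    (hug : ∀ x ∈ closure Ω, ‖gradient u x‖ ≤ 1) (hφg : ∀ x ∈ closure Ω, ‖gradient φ x‖ ≤ 1)
    (hb : ∀ x ∈ frontier Ω, u x = φ x) (hx : x ∈ Ω) :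
    |u x - φ x| ≤ 2 * Metric.diam (closure Ω) := by
  obtain ⟨y, hy, r, hxr, hyr, hr⟩ := exists_mem_frontier_segment_subset hΩo hΩb hx
  have hlip : ∀ {v : EuclideanSpace ℝ (Fin 2) → ℝ}, (∀ x ∈ closure Ω, DifferentiableAt ℝ v x) →
      (∀ x ∈ closure Ω, ‖gradient v x‖ ≤ 1) → |v x - v y| ≤ Metric.diam (closure Ω) := by
    intro v hv hvg
    have h := (convex_closedBall x r).norm_image_sub_le_of_norm_fderiv_le
      (fun z hz => hv z (hr hz)) (fun z hz => norm_gradient_eq_norm_fderiv.symm.trans_le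
        (hvg z (hr hz))) hyr hxr
    rw [one_mul, ← dist_eq_norm, ← dist_eq_norm] at h
    exact h.trans (dist_le_diam_of_mem hΩb.closure (hr hxr) (hr hyr))
  have h1 := hlip hu hug
  have h2 := hlip hφ hφg
  have h3 := hb y hy
  rw [abs_le] at h1 h2 ⊢
  constructor <;> linarith

lemma mul_add_mul_le_mul_of_sq_eq {n c p q a b : ℝ} (hn : 0 ≤ n) (hc : 0 ≤ c) (h1 : n ^ 2 = p ^ 2 + q ^ 2)
    (h2 : c ^ 2 = a ^ 2 + b ^ 2) : p * a + q * b ≤ n * c := by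
  refine (le_abs_self _).trans (abs_le_of_sq_le_sq ?_ (mul_nonneg hn hc))
  rw [mul_pow, h1, h2]
  nlinarith [sq_nonneg (p * b - q * a)]

lemma tilt_mul_gradient_ge (hθ : θ ∈ Ioo (0 : ℝ) (1 / 4)) (hu : ‖gradient u x‖ < 1)
    (hχ : ‖gradient χ x‖ ≤ 1 - 3 * θ) :
    θ * tilt u x - 2 / θ ≤ tilt u x * (pderiv 0 u x * (pderiv 0 u x - pderiv 0 χ x) +
      pderiv 1 u x * (pderiv 1 u x - pderiv 1 χ x)) := by
  obtain ⟨hθ0, hθ1⟩ := hθ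
  have h1 := norm_gradient_sq (u := u) (x := x)
  have h2 := norm_gradient_sq (u := χ) (x := x)
  have hn := norm_nonneg (gradient u x)
  have hin := mul_add_mul_le_mul_of_sq_eq hn (norm_nonneg (gradient χ x)) h1 h2
  have hw := one_le_tilt hu
  have hs := tilt_sq_mul hu
  rw [← h1] at hs
  have h3 := mul_le_mul_of_nonneg_left hχ hn
  set n := ‖gradient u x‖
  set w := tilt u x
  have h4 : n * (n - 1 + 3 * θ) ≤ pderiv 0 u x * (pderiv 0 u x - pderiv 0 χ x) +
      pderiv 1 u x * (pderiv 1 u x - pderiv 1 χ x) := by nlinarith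
  refine le_trans ?_ (mul_le_mul_of_nonneg_left h4 (by linarith : 0 ≤ w))
  have hθ' : 0 < 2 / θ := by positivity
  rcases le_total (1 - θ) n with h | h
  · have : θ ≤ n * (n - 1 + 3 * θ) := by nlinarith
    nlinarith [mul_le_mul_of_nonneg_left this (by linarith : 0 ≤ w)]
  · have h5 : θ ≤ 1 - n ^ 2 := by nlinarith
    have h6 : w ^ 2 * θ ≤ 1 := hs ▸ mul_le_mul_of_nonneg_left h5 (sq_nonneg w)
    have h7 : w ≤ 1 / θ := by
      rw [le_div_iff₀ hθ0]
      nlinarith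
    have h8 : -1 + θ ≤ n * (n - 1 + 3 * θ) := by nlinarith
    have e : 2 / θ = 2 * (1 / θ) := by ring
    rw [e]
    nlinarith [mul_le_mul_of_nonneg_left h8 (by linarith : 0 ≤ w)]

/-- Energy bound on the set where `u` lies above the barrier `χ`. -/
lemma exists_setIntegral_tilt_superlevel_le (hΩo : IsOpen Ω) (hΩb : Bornology.IsBounded Ω)
    (hθ : θ ∈ Ioo (0 : ℝ) (1 / 4)) (hΛ : 0 ≤ Λ) {t M I : ℝ} (ht : 0 < t) (hI : 0 ≤ I) :
    ∃ C : ℝ, ∀ χ u ρ : EuclideanSpace ℝ (Fin 2) → ℝ, ContDiff ℝ 1 χ →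
      (∀ x ∈ Ω, ‖gradient χ x‖ ≤ 1 - 3 * θ) → ContDiffOn ℝ 2 u Ω → ContinuousOn u (closure Ω) →
      (∀ x ∈ Ω, ‖gradient u x‖ < 1) → (∀ x ∈ frontier Ω, u x = χ x) →
      (∀ x ∈ Ω, u x - χ x ≤ M) → ContinuousOn ρ Ω →
      (∀ x ∈ Ω, |lorentzMeanCurv u x - ρ x| ≤ Λ * tilt u x) →
      (∫⁻ x in Ω, ENNReal.ofReal |ρ x|) ≤ ENNReal.ofReal I →
      ∃ L ⊆ Ω, IsCompact L ∧ (∀ x ∈ Ω, t ≤ u x - χ x → x ∈ L) ∧ ∫ x in L, tilt u x ≤ C := by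
  have hθ0 := hθ.1
  obtain ⟨f, hf, hf0, hfn, hfd, hf1⟩ := exists_exp_cutoff (k := 2 * Λ / θ + 1) (half_pos ht)
  obtain ⟨B, hB⟩ := (isCompact_Icc (a := (0 : ℝ)) (b := M)).exists_bound_of_continuousOn
    hf.continuous.continuousOn
  obtain ⟨B', hB'⟩ := (isCompact_Icc (a := (0 : ℝ)) (b := M)).exists_bound_of_continuousOn
    (hf.continuous_deriv le_rfl).continuousOn
  refine ⟨2 / θ * (|B| * I + 2 / θ * |B'| * volume.real Ω), ?_⟩
  intro χ u ρ hχ hχg hu huc hug hb hM hρ hH hρI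
  have hclosed : ∀ s : ℝ, IsClosed (closure Ω ∩ (fun x => u x - χ x) ⁻¹' Ici s) := fun s =>
    (huc.sub hχ.continuous.continuousOn).preimage_isClosed_of_isClosed isClosed_closure isClosed_Ici
  have hcompact : ∀ s : ℝ, IsCompact (closure Ω ∩ (fun x => u x - χ x) ⁻¹' Ici s) := fun s =>
    hΩb.isCompact_closure.of_isClosed_subset (hclosed s) inter_subset_left
  have hsub : ∀ s : ℝ, 0 < s → closure Ω ∩ (fun x => u x - χ x) ⁻¹' Ici s ⊆ Ω := by
    rintro s hs x ⟨hx, hxs⟩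
    by_contra h
    have hx' : x ∈ frontier Ω := by rw [hΩo.frontier_eq]; exact ⟨hx, h⟩
    simp only [mem_preimage, mem_Ici, hb x hx', sub_self] at hxs
    linarith
  set L := closure Ω ∩ (fun x => u x - χ x) ⁻¹' Ici (t / 2)
  set L' := closure Ω ∩ (fun x => u x - χ x) ⁻¹' Ici t
  have hLc : IsCompact L := hcompact _
  have hLΩ : L ⊆ Ω := hsub _ (half_pos ht)
  have hLL : L' ⊆ L := fun x hx => ⟨hx.1, (half_le_self ht.le).trans hx.2⟩
  refine ⟨L', hsub t ht, hcompact t, fun x hx hxt => ⟨subset_closure hx, hxt⟩, ?_⟩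
  have hwd : ContDiffOn ℝ 1 (tilt u) Ω := contDiffOn_tilt hΩo hu (by norm_num) hug
  have hu1 : ContDiffOn ℝ 1 u Ω := hu.of_le (by norm_num)
  have hd1 : ∀ i, ContDiffOn ℝ 1 (pderiv i u) Ω := fun i => contDiffOn_pderiv hΩo hu (by norm_num)
  set g : EuclideanSpace ℝ (Fin 2) → ℝ := fun x => u x - χ x
  have hgd : ContDiffOn ℝ 1 g Ω := hu1.sub hχ.contDiffOn
  have hfg : ContDiffOn ℝ 1 (fun x => f (g x)) Ω := hf.comp_contDiffOn hgd
  set Y : Fin 2 → EuclideanSpace ℝ (Fin 2) → ℝ := fun i y => f (g y) * (tilt u y * pderiv i u y)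
    with hY
  have hYd : ∀ i, ContDiffOn ℝ 1 (Y i) Ω := fun i => hfg.mul (hwd.mul (hd1 i))
  have hY0 : ∀ i, ∀ x ∈ Ω, x ∉ L → Y i x = 0 := fun i x hx hxL => by
    have : g x ≤ t / 2 := not_lt.1 fun h => hxL ⟨subset_closure hx, h.le⟩
    simp [hY, hf0 _ this]
  have hint : ∀ {F : EuclideanSpace ℝ (Fin 2) → ℝ}, ContinuousOn F Ω → IntegrableOn F L :=
    fun hF => (hF.mono hLΩ).integrableOn_compact hLc
  have hYc : ∀ i, ContinuousOn (pderiv i (Y i)) Ω := fun i =>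
    (contDiffOn_pderiv hΩo (hYd i) (m := 0) (by norm_num)).continuousOn
  have hZ : ∫ x in L, ∑ i, pderiv i (Y i) x = 0 := by
    rw [integral_finsetSum _ fun i _ => hint (hYc i)]
    exact Finset.sum_eq_zero fun i _ =>
      setIntegral_compact_pderiv_eq_zero hΩo hLc hLΩ (hYd i) (hY0 i) i
  have hZc : ContinuousOn (fun x => ∑ i, pderiv i (Y i) x) Ω :=
    continuousOn_finsetSum _ fun i _ => hYc i
  have hpt : ∀ x ∈ L, θ / 2 * (deriv f (g x) * tilt u x) ≤
      ∑ i, pderiv i (Y i) x + |B| * |ρ x| + 2 / θ * |B'| := by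
    intro x hxL
    have hx := hLΩ hxL
    have hgx : g x ∈ Icc 0 M := ⟨(half_pos ht).le.trans hxL.2, hM x hx⟩
    have hw := one_le_tilt (hug x hx)
    have hdf := hfd (g x)
    have hf' : 0 ≤ deriv f (g x) := (mul_nonneg (by positivity) (hfn _)).trans hdf
    have hderiv : ∀ i, pderiv i (fun y => f (g y)) x =
        deriv f (g x) * (pderiv i u x - pderiv i χ x) := fun i => by
      rw [pderiv_comp (hf.differentiable one_ne_zero _).hasDerivAt
        (hgd.differentiableAt_of_isOpen hΩo hx), pderiv_sub
        (hu1.differentiableAt_of_isOpen hΩo hx) (hχ.differentiable one_ne_zero x)]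
    rw [sum_pderiv_mul_tilt hΩo hu hug (hfg.differentiableAt_of_isOpen hΩo hx) hx, hderiv, hderiv]
    have h1 := mul_le_mul_of_nonneg_left (tilt_mul_gradient_ge hθ (hug x hx) (hχg x hx)) hf'
    have h2 : -(|ρ x| + Λ * tilt u x) ≤ lorentzMeanCurv u x := by
      have := (abs_le.1 (hH x hx)).1
      linarith [neg_abs_le (ρ x)]
    have h3 := mul_le_mul_of_nonneg_left h2 (hfn (g x))
    have h4 : f (g x) * |ρ x| ≤ |B| * |ρ x| := mul_le_mul_of_nonneg_right
      ((le_abs_self _).trans ((hB _ hgx).trans (le_abs_self B))) (abs_nonneg _)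
    have h5 : deriv f (g x) * (2 / θ) ≤ |B'| * (2 / θ) := mul_le_mul_of_nonneg_right
      ((le_abs_self _).trans ((hB' _ hgx).trans (le_abs_self B'))) (by positivity)
    have h6 : Λ * f (g x) ≤ θ / 2 * deriv f (g x) := by
      have e : θ / 2 * ((2 * Λ / θ + 1) * f (g x)) = Λ * f (g x) + θ / 2 * f (g x) := by
        field_simp
      have := mul_le_mul_of_nonneg_left hdf (by positivity : 0 ≤ θ / 2)
      have := mul_nonneg (by positivity : 0 ≤ θ / 2) (hfn (g x))
      linarith
    have h7 := mul_le_mul_of_nonneg_right h6 (by linarith : 0 ≤ tilt u x)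
    linarith
  have hdfc : ContinuousOn (fun x => deriv f (g x)) Ω :=
    (hf.continuous_deriv le_rfl).comp_continuousOn hgd.continuousOn
  have hwc := hwd.continuousOn
  have hdfn : ∀ s, 0 ≤ deriv f s := fun s => (mul_nonneg (by positivity) (hfn _)).trans (hfd s)
  have hmain : θ / 2 * ∫ x in L', tilt u x ≤ |B| * I + 2 / θ * |B'| * volume.real Ω := by
    calc θ / 2 * ∫ x in L', tilt u x = ∫ x in L', θ / 2 * tilt u x := (integral_const_mul _ _).symm
      _ ≤ ∫ x in L', θ / 2 * (deriv f (g x) * tilt u x) := by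
          refine setIntegral_mono_on ((hint (by fun_prop)).mono_set hLL)
            ((hint (by fun_prop)).mono_set hLL) (hclosed t).measurableSet fun x hx => ?_
          have h1 : 1 ≤ f (g x) := by
            rw [hf1 _ (by rw [mul_div_cancel₀ _ two_ne_zero]; exact hx.2)]
            have : 0 ≤ g x := ht.le.trans hx.2
            exact Real.one_le_exp (by positivity)
          have h2 := hfd (g x)
          have h3 : 1 ≤ deriv f (g x) := by
            have : 0 ≤ 2 * Λ / θ := by positivity
            nlinarith
          exact mul_le_mul_of_nonneg_left (le_mul_of_one_le_left tilt_nonneg h3) (by positivity)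
      _ ≤ ∫ x in L, θ / 2 * (deriv f (g x) * tilt u x) :=
          setIntegral_mono_set (hint (by fun_prop)) (Filter.Eventually.of_forall fun x =>
            mul_nonneg (by positivity) (mul_nonneg (hdfn _) tilt_nonneg))
            (Filter.Eventually.of_forall hLL)
      _ ≤ ∫ x in L, (∑ i, pderiv i (Y i) x + |B| * |ρ x| + 2 / θ * |B'|) :=
          setIntegral_mono_on (hint (by fun_prop)) (hint (by fun_prop)) hLc.measurableSet hpt
      _ = |B| * (∫ x in L, |ρ x|) + ∫ x in L, 2 / θ * |B'| := by
          rw [integral_add (hint (by fun_prop)) (hint (by fun_prop)),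
            integral_add (hint hZc) (hint (by fun_prop)), hZ, integral_const_mul, zero_add]
      _ ≤ _ := by
          refine add_le_add (mul_le_mul_of_nonneg_left ?_ (abs_nonneg _))
            (setIntegral_const_le hLΩ hΩb (by positivity))
          exact setIntegral_le_of_lintegral_le hLΩ (fun x => abs_nonneg _)
            (hint hρ.abs).aestronglyMeasurable hI hρI
  have := mul_le_mul_of_nonneg_left hmain (by positivity : 0 ≤ 2 / θ)
  rwa [← mul_assoc, show 2 / θ * (θ / 2) = 1 by field_simp, one_mul] at this

lemma gradient_neg_apply : gradient (fun y => -u y) x = -gradient u x := by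
  simp [gradient]

lemma tilt_neg : tilt (fun y => -u y) x = tilt u x := by
  simp [tilt, gradient_neg_apply]

lemma lorentzMeanCurv_neg : lorentzMeanCurv (fun y => -u y) x = -lorentzMeanCurv u x := by
  have h : ∀ i y, pderiv i (fun z => -u z) y = -pderiv i u y := fun i y => pderiv_neg
  simp only [lorentzMeanCurv_eq, tilt_neg, h, mul_neg, pderiv_neg, Finset.sum_neg_distrib]

lemma IsAdmissible.neg (h : IsAdmissible Ω φ Λ u ρ) :
    IsAdmissible Ω (fun x => -φ x) Λ (fun x => -u x) (fun x => -ρ x) := by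
  obtain ⟨⟨V, hV, hΩV, hu⟩, hg, hb, hρ, hH⟩ := h
  refine ⟨⟨V, hV, hΩV, hu.neg⟩, fun x hx => ?_, fun x hx => congrArg Neg.neg (hb x hx), hρ.neg, fun x hx => ?_⟩
  · rw [gradient_neg_apply, norm_neg]
    exact hg x hx
  · rw [lorentzMeanCurv_neg, tilt_neg, ← neg_sub', abs_neg]
    exact hH x hx

lemma IsAdmissible.contDiffOn (h : IsAdmissible Ω φ Λ u ρ) {n : ℕ} : ContDiffOn ℝ n u Ω := by
  obtain ⟨⟨V, -, hΩV, hu⟩, -⟩ := h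
  exact (hu.mono (subset_closure.trans hΩV)).of_le (by exact_mod_cast le_top)

/-- Energy bound on the part of a compact set where `u` lies above its boundary datum. -/
lemma exists_setIntegral_tilt_le_of_le (hΩo : IsOpen Ω) (hΩb : Bornology.IsBounded Ω)
    (hθ : θ ∈ Ioo (0 : ℝ) (1 / 4)) (hφ : ContDiff ℝ 1 φ)
    (hφg : ∀ x ∈ closure Ω, ‖gradient φ x‖ ≤ 1 - 4 * θ) (hΛ : 0 ≤ Λ)
    {K : Set (EuclideanSpace ℝ (Fin 2))} (hK : IsCompact K) (hKΩ : K ⊆ Ω) {I : ℝ} (hI : 0 ≤ I) :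
    ∃ C : ℝ, ∀ u ρ : EuclideanSpace ℝ (Fin 2) → ℝ, IsAdmissible Ω φ Λ u ρ →
      (∫⁻ x in Ω, ENNReal.ofReal |ρ x|) ≤ ENNReal.ofReal I →
      ∀ s ⊆ K, (∀ x ∈ s, φ x ≤ u x) → ∫ x in s, tilt u x ≤ C := by
  obtain ⟨ψ, L, D, hψ, hψ01, hψ1, -, hLΩ, hψ0, hD⟩ := exists_cutoff hΩo hK hKΩ
  have hθ0 := hθ.1
  have hθ1 := hθ.2
  have hD0 : 0 ≤ D := (norm_nonneg _).trans (hD 0)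
  set t : ℝ := θ / (D + 1)
  have ht : 0 < t := by positivity
  have htD : t * D ≤ θ := by
    rw [div_mul_eq_mul_div, div_le_iff₀ (by positivity)]
    nlinarith
  obtain ⟨C, hC⟩ := exists_setIntegral_tilt_superlevel_le (M := 2 * Metric.diam (closure Ω) + t)
    hΩo hΩb hθ hΛ ht hI
  refine ⟨C, fun u ρ hadm hρI s hsK hs => ?_⟩
  have hu2 : ContDiffOn ℝ 2 u Ω := hadm.contDiffOn (n := 2)
  obtain ⟨⟨V, hV, hΩV, hu⟩, hg, hb, hρ, hH⟩ := hadm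
  have hud : ∀ x ∈ closure Ω, DifferentiableAt ℝ u x := fun x hx =>
    (hu.contDiffAt (hV.mem_nhds (hΩV hx))).differentiableAt (by simp)
  have hχ : ContDiff ℝ 1 (fun x => φ x - t * ψ x) := hφ.sub (contDiff_const.mul hψ)
  have hχg : ∀ x ∈ Ω, ‖gradient (fun x => φ x - t * ψ x) x‖ ≤ 1 - 3 * θ := fun x hx => by
    have h1 := hφg x (subset_closure hx)
    rw [norm_gradient_eq_norm_fderiv] at h1 ⊢
    have dψ := hψ.differentiable one_ne_zero x
    rw [fderiv_fun_sub (hφ.differentiable one_ne_zero x) (dψ.const_mul t), fderiv_const_mul dψ]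
    refine (norm_sub_le _ _).trans ?_
    rw [norm_smul, Real.norm_of_nonneg ht.le]
    linarith [mul_le_mul_of_nonneg_left (hD x) ht.le]
  have hχb : ∀ x ∈ frontier Ω, u x = φ x - t * ψ x := fun x hx => by
    have hxL : x ∉ L := fun h => by
      rw [hΩo.frontier_eq] at hx
      exact hx.2 (hLΩ h)
    rw [hb x hx, hψ0 x hxL, mul_zero, sub_zero]
  have hχM : ∀ x ∈ Ω, u x - (φ x - t * ψ x) ≤ 2 * Metric.diam (closure Ω) + t := fun x hx => by
    have h1 := abs_sub_le_of_eq_on_frontier hΩo hΩb hud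
      (fun x _ => hφ.differentiable one_ne_zero x) (fun x hx => (hg x hx).le)
      (fun x hx => (hφg x hx).trans (by linarith)) hb hx
    have := mul_le_mul_of_nonneg_left (hψ01 x).2 ht.le
    linarith [le_abs_self (u x - φ x)]
  obtain ⟨L', hL'Ω, hL'c, hL', hC'⟩ := hC _ u ρ hχ hχg hu2 (hu.continuousOn.mono hΩV)
    (fun x hx => hg x (subset_closure hx)) hχb hχM hρ hH hρI
  have hw : ContinuousOn (tilt u) Ω := (contDiffOn_tilt hΩo hu2 (m := 1) (by norm_num)
    fun x hx => hg x (subset_closure hx)).continuousOn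
  refine (setIntegral_mono_set ((hw.mono hL'Ω).integrableOn_compact hL'c)
    (Filter.Eventually.of_forall fun x => tilt_nonneg) (Filter.Eventually.of_forall
      fun x hx => ?_)).trans hC'
  refine hL' x (hKΩ (hsK hx)) ?_
  rw [hψ1 x (hsK hx)]
  linarith [hs x hx]

/-- Interior energy bound for admissible solutions. -/
lemma exists_setIntegral_tilt_le (hΩo : IsOpen Ω) (hΩb : Bornology.IsBounded Ω)
    (hθ : θ ∈ Ioo (0 : ℝ) (1 / 4)) (hφ : ContDiff ℝ 1 φ)
    (hφg : ∀ x ∈ closure Ω, ‖gradient φ x‖ ≤ 1 - 4 * θ) (hΛ : 0 ≤ Λ)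
    {K : Set (EuclideanSpace ℝ (Fin 2))} (hK : IsCompact K) (hKΩ : K ⊆ Ω) {I : ℝ} (hI : 0 ≤ I) :
    ∃ C : ℝ, ∀ u ρ : EuclideanSpace ℝ (Fin 2) → ℝ, IsAdmissible Ω φ Λ u ρ →
      (∫⁻ x in Ω, ENNReal.ofReal |ρ x|) ≤ ENNReal.ofReal I → ∫ x in K, tilt u x ≤ C := by
  obtain ⟨C₁, h₁⟩ := exists_setIntegral_tilt_le_of_le hΩo hΩb hθ hφ hφg hΛ hK hKΩ hI
  obtain ⟨C₂, h₂⟩ := exists_setIntegral_tilt_le_of_le (φ := fun x => -φ x) hΩo hΩb hθ hφ.neg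
    (fun x hx => by rw [gradient_neg_apply, norm_neg]; exact hφg x hx) hΛ hK hKΩ hI
  refine ⟨C₁ + C₂, fun u ρ hadm hρI => ?_⟩
  have hu2 : ContDiffOn ℝ 2 u Ω := hadm.contDiffOn (n := 2)
  have hw : IntegrableOn (tilt u) K := ((contDiffOn_tilt hΩo hu2 (m := 1) (by norm_num)
    fun x hx => hadm.2.1 x (subset_closure hx)).continuousOn.mono hKΩ).integrableOn_compact hK
  have hS : MeasurableSet (K ∩ (fun x => φ x - u x) ⁻¹' Iic 0) :=
    ((hφ.continuous.continuousOn.sub (hu2.continuousOn.mono hKΩ)).preimage_isClosed_of_isClosed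
      hK.isClosed isClosed_Iic).measurableSet
  rw [← integral_inter_add_sdiff hS hw]
  refine add_le_add (h₁ u ρ hadm hρI _ inter_subset_left fun x hx => sub_nonpos.1 hx.2.2) ?_
  have := h₂ _ _ hadm.neg (by simpa using hρI) (K \ (K ∩ (fun x => φ x - u x) ⁻¹' Iic 0))
    sdiff_subset fun x hx => ?_
  · simpa only [tilt_neg] using this
  · have : ¬ φ x - u x ≤ 0 := fun h => hx.2 ⟨hx.1, h⟩
    linarith

end GlobalEnergy

/-- Higher integrability of the tilt function in dimension `m = 2`:
`∫_{Ω′_ε} w_u ln(1 + w_u) ≤ C` for every admissible solution with `∫_Ω |ρ| ≤ I₁` and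
`‖ρ‖_{L²(Ω′)} ≤ I₂`, with `C = C(Ω, φ, θ, Λ, Ω′, ε, I₁, I₂)`. -/
theorem higher_integrability_dim_two
    (Ω : Set (EuclideanSpace ℝ (Fin 2))) (hΩo : IsOpen Ω) (hΩb : Bornology.IsBounded Ω)
    (θ : ℝ) (hθ : θ ∈ Set.Ioo (0 : ℝ) (1/4))
    (φ : EuclideanSpace ℝ (Fin 2) → ℝ) (hφ : ContDiff ℝ (⊤ : ℕ∞) φ)
    (hφg : ∀ x ∈ closure Ω, ‖gradient φ x‖ ≤ 1 - 4 * θ)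
    (Λ : ℝ) (hΛ : 0 ≤ Λ)
    (Ω' : Set (EuclideanSpace ℝ (Fin 2))) (hΩ'o : IsOpen Ω') (hΩ'sub : Ω' ⊆ Ω)
    (ε : ℝ) (hε : 0 < ε) (I₁ I₂ : ℝ) (hI₁ : 0 ≤ I₁) (hI₂ : 0 ≤ I₂) :
    ∃ C : ℝ, 0 < C ∧
      ∀ u ρ : EuclideanSpace ℝ (Fin 2) → ℝ, IsAdmissible Ω φ Λ u ρ →
        (∫⁻ x in Ω, ENNReal.ofReal |ρ x|) ≤ ENNReal.ofReal I₁ →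
        (∫⁻ x in Ω', ENNReal.ofReal (ρ x ^ 2)) ≤ ENNReal.ofReal (I₂ ^ 2) →
        ∫⁻ x in {x ∈ Ω' | ε < Metric.infDist x (frontier Ω')},
            ENNReal.ofReal (tilt u x * Real.log (1 + tilt u x))
          ≤ ENNReal.ofReal C := by
  set K : Set (EuclideanSpace ℝ (Fin 2)) :=
    closure Ω' ∩ {x | ε ≤ Metric.infDist x (frontier Ω')}
  have hK : IsCompact K := (hΩb.subset hΩ'sub).isCompact_closure.inter_right
    (isClosed_le continuous_const (continuous_infDist_pt _))
  have hKΩ' : K ⊆ Ω' := by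
    rintro x ⟨hx, hxε⟩
    by_contra h
    have hx' : x ∈ frontier Ω' := by rw [hΩ'o.frontier_eq]; exact ⟨hx, h⟩
    exact (hε.trans_le (hxε.trans_eq (infDist_zero_of_mem hx'))).false
  obtain ⟨η, L, D, hη, hη01, hη1, hL, hLΩ', hη0, hD⟩ := exists_cutoff hΩ'o hK hKΩ'
  have hφ1 : ContDiff ℝ 1 φ := hφ.of_le (by exact_mod_cast le_top)
  obtain ⟨W, hW⟩ := exists_setIntegral_tilt_le hΩo hΩb hθ hφ1 hφg hΛ hL (hLΩ'.trans hΩ'sub) hI₁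
  set B : ℝ := 2 * (((D + 1) * W + (8 * I₂ ^ 2 + 8 * (Λ ^ 2 + 2 * D ^ 2) * W)) *
    (I₂ ^ 2 + (2 + Λ + 2 * D) * W + (8 * I₂ ^ 2 + 8 * (Λ ^ 2 + 2 * D ^ 2) * W))) + W
  refine ⟨|B| + 1, by positivity, fun u ρ hadm hρ₁ hρ₂ => ?_⟩
  have hu : ContDiffOn ℝ 3 u Ω' := (hadm.contDiffOn (n := 3)).mono hΩ'sub
  have hg : ∀ x ∈ Ω', ‖gradient u x‖ < 1 := fun x hx => hadm.2.1 x (subset_closure (hΩ'sub hx))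
  have hρ : ContinuousOn ρ Ω' := hadm.2.2.2.1.mono hΩ'sub
  have hP : ∫ x in L, ρ x ^ 2 ≤ I₂ ^ 2 := setIntegral_le_of_lintegral_le hLΩ'
    (fun x => sq_nonneg _) (((hρ.pow 2).mono hLΩ').integrableOn_compact hL).aestronglyMeasurable
    (sq_nonneg _) hρ₂
  have hest := setIntegral_tilt_mul_log_le hΩ'o hL hLΩ' hu hg hη hη0 hη01 hΛ
    (fun i x => (abs_pderiv_le_norm_fderiv η i x).trans (hD x)) hρ
    (fun x hx => hadm.2.2.2.2 x (hΩ'sub hx)) (hW u ρ hadm hρ₁) hP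
  have hwc : ContinuousOn (tilt u) Ω' :=
    (contDiffOn_tilt hΩ'o hu (m := 1) (by norm_num) hg).continuousOn
  have hlc : ContinuousOn (fun x => Real.log (1 + tilt u x)) Ω' :=
    ContinuousOn.log (by fun_prop) fun x hx => by linarith [one_le_tilt (hg x hx)]
  have hηc : ContinuousOn η Ω' := hη.continuous.continuousOn
  have hint : IntegrableOn (fun x => η x ^ 2 * (tilt u x * Real.log (1 + tilt u x))) L :=
    (ContinuousOn.mono (by fun_prop) hLΩ').integrableOn_compact hL
  have hTK : {x ∈ Ω' | ε < Metric.infDist x (frontier Ω')} ⊆ K := fun x hx =>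
    ⟨subset_closure hx.1, hx.2.le⟩
  have hTL : {x ∈ Ω' | ε < Metric.infDist x (frontier Ω')} ⊆ L := fun x hx => by
    by_contra h
    exact one_ne_zero ((hη1 x (hTK hx)).symm.trans (hη0 x h))
  have hTm : MeasurableSet {x ∈ Ω' | ε < Metric.infDist x (frontier Ω')} :=
    (hΩ'o.inter (isOpen_lt continuous_const (continuous_infDist_pt _))).measurableSet
  calc ∫⁻ x in {x ∈ Ω' | ε < Metric.infDist x (frontier Ω')},
        ENNReal.ofReal (tilt u x * Real.log (1 + tilt u x))
      = ∫⁻ x in {x ∈ Ω' | ε < Metric.infDist x (frontier Ω')},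
        ENNReal.ofReal (η x ^ 2 * (tilt u x * Real.log (1 + tilt u x))) :=
        setLIntegral_congr_fun hTm fun x hx => by simp only [hη1 x (hTK hx), one_pow, one_mul]
    _ ≤ ∫⁻ x in L, ENNReal.ofReal (η x ^ 2 * (tilt u x * Real.log (1 + tilt u x))) :=
        lintegral_mono_set hTL
    _ = ENNReal.ofReal (∫ x in L, η x ^ 2 * (tilt u x * Real.log (1 + tilt u x))) :=
        (ofReal_integral_eq_lintegral_ofReal hint (Filter.Eventually.of_forall fun x =>
          mul_nonneg (sq_nonneg _) (mul_nonneg tilt_nonneg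
            (Real.log_nonneg (by linarith [tilt_nonneg (u := u) (x := x)]))))).symm
    _ ≤ ENNReal.ofReal (|B| + 1) :=
        ENNReal.ofReal_le_ofReal (hest.trans (by linarith [le_abs_self B]))
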